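/- For every δ > 0 there exists N(δ) such that the following holds for every n ≥ N(δ). Let t be an integer with δn ≤ t ≤ (2n−6)/9 + 1, set N = ex(n,(t+1)K3) + 2, let χ : E(K_n) → {1,…,N} be a surjective edge-coloring admitting no rainbow copy of (t+2)K3, let H ⊆ K_n be a representative graph of χ, and let (T, M, I) be a maximal tiling triple of H with ideal partition (T1, T2, T3, T4) satisfying |T1| ∈ [t−1, t+1], |M| ∈ ((n−3(t+1))/2 − √(2n)/2, (n−3(t+1))/2], and |I| < √(2n). Let V' denote the set of all non-critical vertices of the triangles of T1. Then the subgraph of H induced by V(M) ∪ V' is triangle-free. -/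

import Mathlib

open Finset

/-- `H` contains `k` pairwise vertex-disjoint triangles. -/
def HasKDisjointTriangles {n : ℕ} (H : SimpleGraph (Fin n)) (k : ℕ) : Prop :=
  ∃ T : Finset (Finset (Fin n)), T.card = k ∧ (∀ s ∈ T, H.IsNClique 3 s) ∧
    (T : Set (Finset (Fin n))).Pairwise fun s₁ s₂ => Disjoint s₁ s₂

/-- Under the edge-coloring `χ`, the graph `H` contains a rainbow copy of `k`
pairwise vertex-disjoint triangles. -/
def HasRainbowKTriangles {n : ℕ} (H : SimpleGraph (Fin n)) (χ : Sym2 (Fin n) → ℕ)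
    (k : ℕ) : Prop :=
  ∃ T : Finset (Finset (Fin n)), T.card = k ∧ (∀ s ∈ T, H.IsNClique 3 s) ∧
    ((T : Set (Finset (Fin n))).Pairwise fun s₁ s₂ => Disjoint s₁ s₂) ∧
    Set.InjOn χ {e : Sym2 (Fin n) | ¬ e.IsDiag ∧ ∃ s ∈ T, ∀ x ∈ e, x ∈ s}

/-- `χ` is a surjective edge-coloring of `K_n` with colors `{1, …, N}`. -/
def IsSurjColoring (n N : ℕ) (χ : Sym2 (Fin n) → ℕ) : Prop :=
  (∀ e : Sym2 (Fin n), ¬ e.IsDiag → χ e ∈ Finset.Icc 1 N) ∧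
  (∀ c ∈ Finset.Icc 1 N, ∃ e : Sym2 (Fin n), ¬ e.IsDiag ∧ χ e = c)

/-- `ex(n, kK₃)`: the maximum number of edges of an `n`-vertex graph containing no `k`
pairwise vertex-disjoint triangles. -/
noncomputable def exTriangles (n k : ℕ) : ℕ :=
  sSup {m : ℕ | ∃ H : SimpleGraph (Fin n), ¬ HasKDisjointTriangles H k ∧
    H.edgeSet.ncard = m}

/-- `H` is a representative graph of the `N`-coloring `χ`: it is rainbow and has
exactly `N` edges. -/
def IsRepGraph {n : ℕ} (χ : Sym2 (Fin n) → ℕ) (N : ℕ) (H : SimpleGraph (Fin n)) : Prop :=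
  H.edgeSet.ncard = N ∧ Set.InjOn χ H.edgeSet

/-- The edge `e` (a set of two vertices) sees the vertex `w` of the triangle `s`:
`w ∈ s` and both endpoints of `e` are adjacent to `w` in `H`. -/
def seesAt {n : ℕ} (H : SimpleGraph (Fin n)) (e s : Finset (Fin n)) (w : Fin n) : Prop :=
  w ∈ s ∧ ∀ u ∈ e, H.Adj u w

/-- The edge `e` sees the triangle `s`. -/
def sees {n : ℕ} (H : SimpleGraph (Fin n)) (e s : Finset (Fin n)) : Prop :=
  ∃ w, seesAt H e s w

/-- The vertex `p` sees the triangle `s`: `p` is adjacent to two distinct vertices of `s`. -/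
def vertexSees {n : ℕ} (H : SimpleGraph (Fin n)) (p : Fin n) (s : Finset (Fin n)) : Prop :=
  ∃ w₁ ∈ s, ∃ w₂ ∈ s, w₁ ≠ w₂ ∧ H.Adj p w₁ ∧ H.Adj p w₂

/-- The triangle `u` sees the triangle `s`: some edge of `u` sees `s`. -/
def triSees {n : ℕ} (H : SimpleGraph (Fin n)) (u s : Finset (Fin n)) : Prop :=
  ∃ a ∈ u, ∃ b ∈ u, a ≠ b ∧ sees H {a, b} s

/-- `(T, M, I)` is a tiling triple of `H`: `T` is a family of pairwise vertex-disjoint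
triangles, `M` is a matching, `I` is an independent set, and `V(T), V(M), I` partition
the vertex set. -/
def IsTilingTriple {n : ℕ} (H : SimpleGraph (Fin n)) (T M : Finset (Finset (Fin n)))
    (I : Finset (Fin n)) : Prop :=
  (∀ s ∈ T, H.IsNClique 3 s) ∧ (∀ e ∈ M, H.IsNClique 2 e) ∧
  (∀ x ∈ I, ∀ y ∈ I, ¬ H.Adj x y) ∧
  (((T ∪ M : Finset (Finset (Fin n))) : Set (Finset (Fin n))).Pairwise
    fun s₁ s₂ => Disjoint s₁ s₂) ∧
  Disjoint ((T ∪ M).biUnion id) I ∧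
  (T ∪ M).biUnion id ∪ I = Finset.univ

/-- `(T, M, I)` is a tiling triple of `H` with `(|T|, |M|)` lexicographically maximal. -/
def IsMaxTilingTriple {n : ℕ} (H : SimpleGraph (Fin n)) (T M : Finset (Finset (Fin n)))
    (I : Finset (Fin n)) : Prop :=
  IsTilingTriple H T M I ∧
  ∀ T' M' : Finset (Finset (Fin n)), ∀ I' : Finset (Fin n), IsTilingTriple H T' M' I' →
    T'.card < T.card ∨ (T'.card = T.card ∧ M'.card ≤ M.card)

/-- The number of edges of `H` between the (disjoint) vertex sets `A` and `B`. -/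
noncomputable def eBetween {n : ℕ} (H : SimpleGraph (Fin n)) (A B : Set (Fin n)) : ℕ :=
  Set.ncard {p : Fin n × Fin n | p.1 ∈ A ∧ p.2 ∈ B ∧ H.Adj p.1 p.2}

/-- `(T₁, T₂, T₃, T₄)` is an ideal partition of `T` for the tiling triple `(T, M, I)`:
`T₁` consists of the triangles of `T` seen by at least two edges of `M`; `T₂` consists of
the triangles of `T ∖ T₁` seen by at least two other members of `T`, or by one edge of
`M` and at least one vertex of `I`; and `(T₃, T₄)` arises from the greedy removal process
on `D = T ∖ (T₁ ∪ T₂)`: while some triangle of `D` sends at most `8(|D|−1)` edges to the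
other triangles of `D`, it is removed (the removed triangles, in order, form `T₃`),
and `T₄` is the final set `D`, in which every triangle sends more than `8(|T₄|−1)`
edges to the other triangles of `T₄`. -/
def IsIdealPartition {n : ℕ} (H : SimpleGraph (Fin n)) (T M : Finset (Finset (Fin n)))
    (I : Finset (Fin n)) (T₁ T₂ T₃ T₄ : Finset (Finset (Fin n))) : Prop :=
  T₁ ∪ T₂ ∪ T₃ ∪ T₄ = T ∧
  Disjoint T₁ T₂ ∧ Disjoint T₁ T₃ ∧ Disjoint T₁ T₄ ∧
  Disjoint T₂ T₃ ∧ Disjoint T₂ T₄ ∧ Disjoint T₃ T₄ ∧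
  (∀ s, s ∈ T₁ ↔ s ∈ T ∧ ∃ e₁ ∈ M, ∃ e₂ ∈ M, e₁ ≠ e₂ ∧ sees H e₁ s ∧ sees H e₂ s) ∧
  (∀ s, s ∈ T₂ ↔ s ∈ T ∧ s ∉ T₁ ∧
    ((∃ s₁ ∈ T, ∃ s₂ ∈ T, s₁ ≠ s₂ ∧ s₁ ≠ s ∧ s₂ ≠ s ∧ triSees H s₁ s ∧ triSees H s₂ s) ∨
      ((∃ e ∈ M, sees H e s) ∧ (∃ p ∈ I, vertexSees H p s)))) ∧
  (∃ k : ℕ, ∃ g : Fin k → Finset (Fin n), Function.Injective g ∧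
    Finset.image g Finset.univ = T₃ ∧
    ∀ j : Fin k,
      eBetween H (↑(g j))
          (↑((((Finset.univ.filter fun i : Fin k => j < i).image g) ∪ T₄).biUnion id))
        ≤ 8 * (k - (j : ℕ) + T₄.card - 1)) ∧
  (∀ s ∈ T₄, 8 * (T₄.card - 1) < eBetween H (↑s) (↑((T₄.erase s).biUnion id)))

/-- `x` is the critical vertex of the triangle `s` (with respect to the matching `M`):
some edge of `M` sees `x` of `s`, and every edge of `M` seeing `s` sees only `x` of `s`. -/
def IsCriticalVertex {n : ℕ} (H : SimpleGraph (Fin n)) (M : Finset (Finset (Fin n)))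
    (s : Finset (Fin n)) (x : Fin n) : Prop :=
  x ∈ s ∧ (∃ e ∈ M, seesAt H e s x) ∧ ∀ e ∈ M, ∀ w, seesAt H e s w → w = x

/-- The set of non-critical vertices of the triangles in `T₁`. -/
def nonCriticalVerts {n : ℕ} (H : SimpleGraph (Fin n)) (M T₁ : Finset (Finset (Fin n))) :
    Set (Fin n) :=
  {w | ∃ s ∈ T₁, ∃ x, IsCriticalVertex H M s x ∧ w ∈ s ∧ w ≠ x}

section AdjCount

variable {n : ℕ} (H : SimpleGraph (Fin n))

open scoped Classical in
/-- The number of ordered pairs `(a, b) ∈ A × B` with `a` adjacent to `b`. -/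
noncomputable def adjCount (A B : Finset (Fin n)) : ℕ :=
  ∑ a ∈ A, ∑ b ∈ B, if H.Adj a b then 1 else 0

lemma adjCount_comm (A B : Finset (Fin n)) : adjCount H A B = adjCount H B A := by
  classical
  unfold adjCount
  rw [Finset.sum_comm]
  exact Finset.sum_congr rfl fun b _ => Finset.sum_congr rfl fun a _ =>
    if_congr (H.adj_comm a b) rfl rfl

lemma adjCount_union_right {A B C : Finset (Fin n)} (h : Disjoint B C) :
    adjCount H A (B ∪ C) = adjCount H A B + adjCount H A C := by
  unfold adjCount
  simp only [Finset.sum_union h, Finset.sum_add_distrib]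

lemma adjCount_union_left {A B C : Finset (Fin n)} (h : Disjoint A B) :
    adjCount H (A ∪ B) C = adjCount H A C + adjCount H B C := by
  unfold adjCount
  rw [Finset.sum_union h]

lemma adjCount_union_self {A B : Finset (Fin n)} (h : Disjoint A B) :
    adjCount H (A ∪ B) (A ∪ B) = adjCount H A A + 2 * adjCount H A B + adjCount H B B := by
  rw [adjCount_union_left H h, adjCount_union_right H h, adjCount_union_right H h,
    adjCount_comm H B A]
  ring

lemma adjCount_biUnion_left {F : Finset (Finset (Fin n))}
    (h : (F : Set (Finset (Fin n))).Pairwise fun s₁ s₂ => Disjoint s₁ s₂) (C : Finset (Fin n)) :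
    adjCount H (F.biUnion id) C = ∑ s ∈ F, adjCount H s C := by
  unfold adjCount
  rw [Finset.sum_biUnion]
  · rfl
  · exact h

lemma adjCount_biUnion_right {F : Finset (Finset (Fin n))}
    (h : (F : Set (Finset (Fin n))).Pairwise fun s₁ s₂ => Disjoint s₁ s₂) (C : Finset (Fin n)) :
    adjCount H C (F.biUnion id) = ∑ s ∈ F, adjCount H C s := by
  rw [adjCount_comm, adjCount_biUnion_left H h]
  exact Finset.sum_congr rfl fun s _ => adjCount_comm H s C

lemma adjCount_eq_sum_left (A B : Finset (Fin n)) :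
    adjCount H A B = ∑ a ∈ A, adjCount H {a} B := by
  simp [adjCount]

lemma adjCount_eq_sum_right (A B : Finset (Fin n)) :
    adjCount H A B = ∑ b ∈ B, adjCount H A {b} := by
  rw [adjCount_comm, adjCount_eq_sum_left]
  exact Finset.sum_congr rfl fun b _ => adjCount_comm H _ _

lemma adjCount_singleton (A : Finset (Fin n)) (b : Fin n) [DecidablePred fun a => H.Adj a b] :
    adjCount H A {b} = (A.filter fun a => H.Adj a b).card := by
  simp only [adjCount, Finset.sum_singleton, Finset.card_filter]
  exact Finset.sum_congr rfl fun a _ => by congr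

lemma adjCount_le_mul (A B : Finset (Fin n)) : adjCount H A B ≤ A.card * B.card := by
  unfold adjCount
  calc _ ≤ ∑ a ∈ A, ∑ b ∈ B, 1 :=
        Finset.sum_le_sum fun a _ => Finset.sum_le_sum fun b _ => by split_ifs <;> simp
    _ = _ := by simp

lemma adjCount_univ : adjCount H univ univ = 2 * H.edgeSet.ncard := by
  classical
  rw [← SimpleGraph.coe_edgeFinset, Set.ncard_coe_finset,
    ← H.sum_degrees_eq_twice_card_edges]
  unfold adjCount
  refine Finset.sum_congr rfl fun a _ => ?_
  rw [← SimpleGraph.card_neighborFinset_eq_degree, SimpleGraph.neighborFinset_eq_filter,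
    Finset.card_filter]

/-- Mantel's theorem, with edges counted twice. -/
lemma two_mul_adjCount_self_le {X : Finset (Fin n)}
    (hX : ∀ a ∈ X, ∀ b ∈ X, ∀ c ∈ X, H.Adj a b → H.Adj b c → H.Adj a c → False) :
    2 * adjCount H X X ≤ X.card ^ 2 := by
  classical
  set d : Fin n → ℕ := fun a => adjCount H X {a} with hd
  have hsum : adjCount H X X = ∑ a ∈ X, d a := adjCount_eq_sum_right H X X
  have hdeg : ∀ a ∈ X, ∀ b ∈ X, H.Adj a b → d a + d b ≤ X.card := by
    intro a ha b hb hab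
    simp only [hd, adjCount_singleton]
    rw [← Finset.card_union_of_disjoint]
    · exact Finset.card_le_card (by grind)
    · rw [Finset.disjoint_filter]
      intro c hc h1 h2
      exact hX c hc a ha b hb h1 hab h2
  have hsq : ∑ a ∈ X, ∑ b ∈ X, (if H.Adj a b then d a + d b else 0) = 2 * ∑ a ∈ X, d a ^ 2 := by
    have h1 : ∀ a b, (if H.Adj a b then d a + d b else 0)
        = d a * (if H.Adj b a then 1 else 0) + d b * (if H.Adj a b then 1 else 0) := by
      intro a b
      rw [H.adj_comm b a]
      split_ifs <;> simp
    simp only [h1, Finset.sum_add_distrib]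
    rw [Finset.sum_comm (f := fun a b => d b * (if H.Adj a b then 1 else 0))]
    simp only [← Finset.mul_sum]
    have h2 : ∀ a, ∑ b ∈ X, (if H.Adj b a then 1 else 0) = d a := by
      intro a
      simp only [hd, adjCount_singleton, Finset.card_filter]
    simp only [h2]
    rw [two_mul]
    congr 1 <;> exact Finset.sum_congr rfl fun a _ => by ring
  have hle : ∑ a ∈ X, ∑ b ∈ X, (if H.Adj a b then d a + d b else 0)
      ≤ X.card * adjCount H X X := by
    unfold adjCount
    simp only [Finset.mul_sum]
    refine Finset.sum_le_sum fun a ha => Finset.sum_le_sum fun b hb => ?_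
    split_ifs with h
    · simpa using hdeg a ha b hb h
    · simp
  have hcs : (∑ a ∈ X, d a) ^ 2 ≤ X.card * ∑ a ∈ X, d a ^ 2 := sq_sum_le_card_mul_sum_sq
  rw [← hsum] at hcs
  rw [hsq] at hle
  rcases Nat.eq_zero_or_pos (adjCount H X X) with h0 | h0
  · rw [h0]; simp
  · refine Nat.le_of_mul_le_mul_right ?_ h0
    nlinarith

end AdjCount

section Tilings

variable {n : ℕ}

/-- Every vertex set splits into a matching and an independent set. -/
lemma exists_matching_indep (H : SimpleGraph (Fin n)) (Y : Finset (Fin n)) :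
    ∃ (M : Finset (Finset (Fin n))) (I : Finset (Fin n)),
      (∀ e ∈ M, H.IsNClique 2 e) ∧ (∀ x ∈ I, ∀ y ∈ I, ¬ H.Adj x y) ∧
      (M : Set (Finset (Fin n))).Pairwise (fun s₁ s₂ => Disjoint s₁ s₂) ∧
      Disjoint (M.biUnion id) I ∧ M.biUnion id ∪ I = Y := by
  induction Y using Finset.strongInduction with
  | H Y ih =>
    by_cases hY : ∀ x ∈ Y, ∀ y ∈ Y, ¬ H.Adj x y
    · exact ⟨∅, Y, by simp, hY, by simp, by simp, by simp⟩
    · push Not at hY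
      obtain ⟨x, hx, y, hy, hxy⟩ := hY
      have hsub : (Y.erase x).erase y ⊂ Y :=
        (Finset.erase_subset _ _).trans_ssubset (Finset.erase_ssubset hx)
      obtain ⟨M, I, h1, h2, h3, h4, h5⟩ := ih _ hsub
      have hout : ∀ e ∈ M, ∀ v ∈ e, v ≠ x ∧ v ≠ y ∧ v ∈ Y := by
        intro e he v hv
        have : v ∈ M.biUnion id ∪ I :=
          Finset.mem_union_left _ (Finset.mem_biUnion.2 ⟨e, he, hv⟩)
        rw [h5] at this
        simp only [Finset.mem_erase] at this
        tauto
      have hI : ∀ v ∈ I, v ≠ x ∧ v ≠ y ∧ v ∈ Y := by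
        intro v hv
        have : v ∈ M.biUnion id ∪ I := Finset.mem_union_right _ hv
        rw [h5] at this
        simp only [Finset.mem_erase] at this
        tauto
      have hd : ∀ e ∈ M, Disjoint {x, y} e := by
        intro e he
        rw [Finset.disjoint_left]
        intro v hv hve
        have := hout e he v hve
        simp only [Finset.mem_insert, Finset.mem_singleton] at hv
        tauto
      refine ⟨insert {x, y} M, I, ?_, h2, ?_, ?_, ?_⟩
      · intro e he
        rcases Finset.mem_insert.1 he with rfl | he
        · simp [SimpleGraph.isNClique_iff, hxy, hxy.ne]
        · exact h1 e he
      · rw [Finset.coe_insert]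
        refine h3.insert ?_
        intro e he _
        exact ⟨hd e he, (hd e he).symm⟩
      · rw [Finset.biUnion_insert, Finset.disjoint_union_left]
        refine ⟨?_, h4⟩
        rw [Finset.disjoint_left]
        intro v hv hvI
        have := hI v hvI
        simp only [id, Finset.mem_insert, Finset.mem_singleton] at hv
        tauto
      · rw [Finset.biUnion_insert, Finset.union_assoc, h5]
        ext v
        simp only [id, Finset.mem_union, Finset.mem_insert, Finset.mem_singleton,
          Finset.mem_erase]
        grind

/-- A maximal tiling triple has at least as many triangles as any family of
disjoint triangles. -/
lemma IsMaxTilingTriple.card_le {H : SimpleGraph (Fin n)} {T M : Finset (Finset (Fin n))}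
    {I : Finset (Fin n)} (h : IsMaxTilingTriple H T M I) {Q : Finset (Finset (Fin n))}
    (hQ : ∀ s ∈ Q, H.IsNClique 3 s)
    (hd : (Q : Set (Finset (Fin n))).Pairwise fun s₁ s₂ => Disjoint s₁ s₂) :
    Q.card ≤ T.card := by
  obtain ⟨M', I', h1, h2, h3, h4, h5⟩ := exists_matching_indep H (univ \ Q.biUnion id)
  have hM : ∀ e ∈ M', ∀ s ∈ Q, Disjoint s e := by
    intro e he s hs
    rw [Finset.disjoint_left]
    intro v hv hve
    have : v ∈ M'.biUnion id ∪ I' :=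
      Finset.mem_union_left _ (Finset.mem_biUnion.2 ⟨e, he, hve⟩)
    rw [h5, Finset.mem_sdiff] at this
    exact this.2 (Finset.mem_biUnion.2 ⟨s, hs, hv⟩)
  have hI : Disjoint (Q.biUnion id) I' := by
    rw [Finset.disjoint_left]
    intro v hv hve
    have : v ∈ M'.biUnion id ∪ I' := Finset.mem_union_right _ hve
    rw [h5, Finset.mem_sdiff] at this
    exact this.2 hv
  have htil : IsTilingTriple H Q M' I' := by
    refine ⟨hQ, h1, h2, ?_, ?_, ?_⟩
    · intro a ha b hb hab
      rw [Finset.mem_coe, Finset.mem_union] at ha hb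
      rcases ha with ha | ha <;> rcases hb with hb | hb
      · exact hd ha hb hab
      · exact hM b hb a ha
      · exact (hM a ha b hb).symm
      · exact h3 ha hb hab
    · rw [Finset.union_biUnion, Finset.disjoint_union_left]
      exact ⟨hI, h4⟩
    · rw [Finset.union_biUnion, Finset.union_assoc, h5]
      simp
  rcases h.2 _ _ _ htil with h | h <;> omega

/-- In the absence of a rainbow `(k+1)K₃`, a rainbow graph has no `k + 1` disjoint triangles. -/
lemma card_le_of_not_hasRainbow {χ : Sym2 (Fin n) → ℕ} {k : ℕ}
    (hχ : ¬ HasRainbowKTriangles (⊤ : SimpleGraph (Fin n)) χ (k + 1))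
    {H : SimpleGraph (Fin n)} (hH : Set.InjOn χ H.edgeSet) {Q : Finset (Finset (Fin n))}
    (hQ : ∀ s ∈ Q, H.IsNClique 3 s)
    (hd : (Q : Set (Finset (Fin n))).Pairwise fun s₁ s₂ => Disjoint s₁ s₂) :
    Q.card ≤ k := by
  by_contra! hk
  obtain ⟨Q', hQ', hc⟩ := Finset.exists_subset_card_eq (s := Q) (n := k + 1) hk
  refine hχ ⟨Q', hc, fun s hs => (hQ s (hQ' hs)).mono le_top,
    hd.mono (by exact_mod_cast hQ'), hH.mono ?_⟩
  rintro e ⟨hne, s, hs, he⟩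
  induction e using Sym2.ind with
  | _ x y =>
    simp only [Sym2.mem_iff] at he
    rw [Sym2.mk_isDiag_iff] at hne
    exact (hQ s (hQ' hs)).isClique (he x (Or.inl rfl)) (he y (Or.inr rfl)) hne

lemma bddAbove_exTriangles (n k : ℕ) :
    BddAbove {m : ℕ | ∃ H : SimpleGraph (Fin n), ¬ HasKDisjointTriangles H k ∧
      H.edgeSet.ncard = m} := by
  refine ⟨Nat.card (Sym2 (Fin n)), ?_⟩
  rintro m ⟨H, -, rfl⟩
  rw [← Set.ncard_univ]
  exact Set.ncard_le_ncard (Set.subset_univ _)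

lemma hasKDisjointTriangles_of_lt {H : SimpleGraph (Fin n)} {k : ℕ}
    (h : exTriangles n k < H.edgeSet.ncard) : HasKDisjointTriangles H k := by
  by_contra hc
  exact absurd (le_csSup (bddAbove_exTriangles n k) ⟨H, hc, rfl⟩) (not_le.2 h)

/-- The join of a clique on the first `t` vertices with the complete bipartite graph with
parts `[t, t + a)` and `[t + a, n)`. -/
def cliqueJoinBipartite (n t a : ℕ) : SimpleGraph (Fin n) where
  Adj i j := i ≠ j ∧ (i.1 < t ∨ j.1 < t ∨ (i.1 < t + a ∧ t + a ≤ j.1) ∨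
    (j.1 < t + a ∧ t + a ≤ i.1))
  symm := ⟨by intro i j h; tauto⟩
  loopless := ⟨by intro i h; exact h.1 rfl⟩

lemma not_hasKDisjointTriangles_cliqueJoinBipartite (n t a : ℕ) :
    ¬ HasKDisjointTriangles (cliqueJoinBipartite n t a) (t + 1) := by
  rintro ⟨T, hT, hc, hd⟩
  have hex : ∀ s ∈ T, ∃ m : ℕ, m < t ∧ ∃ v ∈ s, v.1 = m := by
    intro s hs
    obtain ⟨x, y, z, hxy, hxz, hyz, rfl⟩ := SimpleGraph.is3Clique_iff.1 (hc s hs)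
    simp only [cliqueJoinBipartite] at hxy hxz hyz
    by_contra! hlt
    have hx : ¬ x.1 < t := fun h => hlt _ h x (by simp) rfl
    have hy : ¬ y.1 < t := fun h => hlt _ h y (by simp) rfl
    have hz : ¬ z.1 < t := fun h => hlt _ h z (by simp) rfl
    omega
  choose! f hft v hv hvf using hex
  have : T.card ≤ (Finset.range t).card := by
    refine Finset.card_le_card_of_injOn f ?_ ?_
    · intro s hs
      simpa using hft s hs
    · intro s hs s' hs' heq
      by_contra hne
      have h : Disjoint s s' := hd hs hs' hne
      rw [Finset.disjoint_left] at h
      refine h (hv s hs) ?_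
      rw [Fin.ext ((hvf s hs).trans (heq.trans (hvf s' hs').symm))]
      exact hv s' hs'
  simp at this
  omega

lemma exTriangles_lower_bound {n t : ℕ} (h : t ≤ n) :
    2 * (n : ℤ) ^ 2 ≤ 4 * exTriangles n (t + 1) + 1 + 2 * t + (n - t) ^ 2 := by
  classical
  obtain ⟨a, b, hab, hn⟩ : ∃ a b : ℕ, (b = a ∨ b = a + 1) ∧ n = t + a + b :=
    ⟨(n - t) / 2, (n - t) - (n - t) / 2, by omega, by omega⟩
  set G := cliqueJoinBipartite n t a
  have hle : G.edgeSet.ncard ≤ exTriangles n (t + 1) :=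
    le_csSup (bddAbove_exTriangles n (t + 1))
      ⟨G, not_hasKDisjointTriangles_cliqueJoinBipartite n t a, rfl⟩
  have hcount := adjCount_univ G
  have hpair : (n : ℤ) * n - t - a * a - b * b ≤ adjCount G univ univ := by
    set f : ℕ → ℕ → ℤ := fun i j => 1 - (if i = j ∧ i < t then 1 else 0)
      - (if (t ≤ i ∧ i < t + a) then 1 else 0) * (if (t ≤ j ∧ j < t + a) then 1 else 0)
      - (if t + a ≤ i then 1 else 0) * (if t + a ≤ j then 1 else 0) with hf
    have h1 : ((adjCount G univ univ : ℕ) : ℤ) = ∑ i : Fin n, ∑ j : Fin n, f i j := by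
      unfold adjCount
      push_cast
      refine Finset.sum_congr rfl fun i _ => Finset.sum_congr rfl fun j _ => ?_
      have hij : i = j ↔ i.1 = j.1 := Fin.ext_iff
      simp only [G, cliqueJoinBipartite, hf, ne_eq, hij]
      split_ifs <;> omega
    have h2 : ∑ i : Fin n, ∑ j : Fin n, f i j = ∑ i ∈ range n, ∑ j ∈ range n, f i j := by
      rw [← Fin.sum_univ_eq_sum_range (fun i => ∑ j ∈ range n, f i j)]
      exact Finset.sum_congr rfl fun i _ => Fin.sum_univ_eq_sum_range (fun j => f i j) n
    have hA : ∑ i ∈ range n, (if (t ≤ i ∧ i < t + a) then (1 : ℤ) else 0) = a := by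
      rw [Finset.sum_boole]
      have : (range n).filter (fun i => t ≤ i ∧ i < t + a) = Ico t (t + a) := by
        ext; simp; omega
      simp [this]
    have hB : ∑ i ∈ range n, (if t + a ≤ i then (1 : ℤ) else 0) = b := by
      rw [Finset.sum_boole]
      have : (range n).filter (fun i => t + a ≤ i) = Ico (t + a) n := by
        ext; simp; omega
      simp [this]; omega
    have hD : ∑ i ∈ range n, ∑ j ∈ range n, (if i = j ∧ i < t then (1 : ℤ) else 0) = t := by
      have : ∀ i ∈ range n, ∑ j ∈ range n, (if i = j ∧ i < t then (1 : ℤ) else 0)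
          = if i < t then 1 else 0 := by
        intro i hi
        simp only [ite_and]
        rw [Finset.sum_ite_eq]
        simp [hi]
      rw [Finset.sum_congr rfl this, Finset.sum_boole]
      have : (range n).filter (fun i => i < t) = range t := by
        ext; simp; omega
      simp [this]
    rw [h1, h2]
    simp only [hf, Finset.sum_sub_distrib, hD, ← Finset.mul_sum, hA, hB, ← Finset.sum_mul]
    simp
  rw [hcount] at hpair
  push_cast at hpair
  have hle' : (G.edgeSet.ncard : ℤ) ≤ exTriangles n (t + 1) := by exact_mod_cast hle
  have hn' : (n : ℤ) = t + a + b := by exact_mod_cast hn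
  rcases hab with hb | hb
  · have : (b : ℤ) = a := by exact_mod_cast hb
    rw [hn', this] at *
    nlinarith
  · have : (b : ℤ) = a + 1 := by exact_mod_cast hb
    rw [hn', this] at *
    nlinarith

end Tilings

section Augmentation

variable {n : ℕ}

/-- A tiling triple in which the number of triangles cannot be exceeded by any family of
disjoint triangles, in unbundled form. -/
structure IsTopTiling (H : SimpleGraph (Fin n)) (T M : Finset (Finset (Fin n)))
    (I : Finset (Fin n)) : Prop where
  tri : ∀ s ∈ T, H.IsNClique 3 s
  edge : ∀ e ∈ M, H.IsNClique 2 e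
  triDisj : ∀ s ∈ T, ∀ s' ∈ T, s ≠ s' → Disjoint s s'
  edgeDisj : ∀ e ∈ M, ∀ e' ∈ M, e ≠ e' → Disjoint e e'
  triEdgeDisj : ∀ s ∈ T, ∀ e ∈ M, Disjoint s e
  indepDisj : ∀ p ∈ I, (∀ s ∈ T, p ∉ s) ∧ ∀ e ∈ M, p ∉ e
  cover : ∀ v, (∃ s ∈ T, v ∈ s) ∨ (∃ e ∈ M, v ∈ e) ∨ v ∈ I
  max : ∀ Q : Finset (Finset (Fin n)), (∀ s ∈ Q, H.IsNClique 3 s) →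
    ((Q : Set (Finset (Fin n))).Pairwise fun s₁ s₂ => Disjoint s₁ s₂) → Q.card ≤ T.card

lemma IsMaxTilingTriple.isTopTiling {H : SimpleGraph (Fin n)} {T M : Finset (Finset (Fin n))}
    {I : Finset (Fin n)} (h : IsMaxTilingTriple H T M I) : IsTopTiling H T M I := by
  obtain ⟨h1, h2, -, h4, h5, h6⟩ := h.1
  refine ⟨h1, h2, ?_, ?_, ?_, ?_, ?_, fun Q hQ hd => h.card_le hQ hd⟩
  · intro s hs s' hs' hne
    exact h4 (by simp [hs]) (by simp [hs']) hne
  · intro s hs s' hs' hne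
    exact h4 (by simp [hs]) (by simp [hs']) hne
  · intro s hs e he
    refine h4 (by simp [hs]) (by simp [he]) ?_
    rintro rfl
    have := (h1 s hs).card_eq
    have := (h2 s he).card_eq
    omega
  · intro p hp
    rw [Finset.disjoint_right] at h5
    have := h5 hp
    simp only [Finset.mem_biUnion, Finset.mem_union, id, not_exists, not_and] at this
    exact ⟨fun s hs => this s (Or.inl hs), fun s hs => this s (Or.inr hs)⟩
  · intro v
    have : v ∈ (T ∪ M).biUnion id ∪ I := by rw [h6]; exact Finset.mem_univ v
    simp only [Finset.mem_biUnion, Finset.mem_union, id] at this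
    grind

open scoped Classical in
/-- The edges of `M` that see the triangle `s`. -/
noncomputable def seers (H : SimpleGraph (Fin n)) (M : Finset (Finset (Fin n)))
    (s : Finset (Fin n)) : Finset (Finset (Fin n)) :=
  M.filter fun e => sees H e s

variable {H : SimpleGraph (Fin n)} {T M : Finset (Finset (Fin n))} {I : Finset (Fin n)}

lemma mem_seers {e s : Finset (Fin n)} : e ∈ seers H M s ↔ e ∈ M ∧ sees H e s := by
  simp [seers]

namespace IsTopTiling

lemma card_le_of_indexed (h : IsTopTiling H T M I) {ι : Type*} [Fintype ι]
    (F : ι → Finset (Fin n)) (hF : ∀ i, H.IsNClique 3 (F i))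
    (hd : ∀ i j, i ≠ j → Disjoint (F i) (F j)) : Fintype.card ι ≤ T.card := by
  classical
  have hinj : Function.Injective F := by
    intro i j hij
    by_contra hne
    have h1 := hd i j hne
    rw [hij, disjoint_self] at h1
    have h2 := (hF j).card_eq
    rw [h1] at h2
    simp at h2
  rw [← Finset.card_univ, ← Finset.card_image_of_injective _ hinj]
  apply h.max
  · intro s hs
    obtain ⟨i, -, rfl⟩ := Finset.mem_image.1 hs
    exact hF i
  · intro s hs s' hs' hne
    obtain ⟨i, -, rfl⟩ := Finset.mem_image.1 (Finset.mem_coe.1 hs)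
    obtain ⟨j, -, rfl⟩ := Finset.mem_image.1 (Finset.mem_coe.1 hs')
    exact hd i j fun hij => hne (by rw [hij])

/-- Replace every triangle `s ∈ S` by `w s` together with a private edge of `M` seeing `w s`,
drop the triangles of `R`, and insert the new triangles `Q`: this cannot gain a triangle. -/
lemma card_le_of_exchange (h : IsTopTiling H T M I) {S R : Finset (Finset (Fin n))}
    (w : Finset (Fin n) → Fin n) (hS : S ⊆ T) (hR : R ⊆ T) (hSR : Disjoint S R)
    (hw : ∀ s ∈ S, ∀ e ∈ seers H M s, seesAt H e s (w s))
    {κ : Type} [Fintype κ] (Q : κ → Finset (Fin n)) (hQ : ∀ i, H.IsNClique 3 (Q i))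
    (hQd : ∀ i j, i ≠ j → Disjoint (Q i) (Q j))
    (hQT : ∀ i, ∀ s ∈ T, s ∉ S → s ∉ R → Disjoint (Q i) s)
    (hQw : ∀ i, ∀ s ∈ S, w s ∉ Q i)
    (hall : ∀ A ⊆ S, A.card ≤
      (A.biUnion fun s => (seers H M s).filter fun e => ∀ i, Disjoint e (Q i)).card) :
    Fintype.card κ ≤ R.card := by
  classical
  have hH : ∃ f : S → Finset (Fin n), Function.Injective f ∧
      ∀ x : S, f x ∈ (seers H M x.1).filter fun e => ∀ i, Disjoint e (Q i) := by
    rw [← Finset.all_card_le_biUnion_card_iff_exists_injective]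
    intro A
    have h1 := hall (A.map (Function.Embedding.subtype _)) (by
      intro x hx
      obtain ⟨y, -, rfl⟩ := Finset.mem_map.1 hx
      exact y.2)
    rw [Finset.card_map] at h1
    refine h1.trans (Finset.card_le_card ?_)
    intro e he
    simp only [Finset.mem_biUnion, Finset.mem_map] at he ⊢
    obtain ⟨_, ⟨y, hy, rfl⟩, he⟩ := he
    exact ⟨y, hy, he⟩
  obtain ⟨f, hinj, hf⟩ := hH
  simp only [Finset.mem_filter] at hf
  have hfM : ∀ x, f x ∈ M := fun x => (mem_seers.1 (hf x).1).1
  have hsee : ∀ x : S, seesAt H (f x) x.1 (w x.1) := fun x => hw _ x.2 _ (hf x).1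
  set F : ({s // s ∈ T \ (S ∪ R)} ⊕ S) ⊕ κ → Finset (Fin n) :=
    Sum.elim (Sum.elim (fun s => s.1) fun s => insert (w s.1) (f s)) Q with hFdef
  have hmem : ∀ x : {s // s ∈ T \ (S ∪ R)}, x.1 ∈ T ∧ x.1 ∉ S ∧ x.1 ∉ R := by
    intro x
    have := x.2
    simp only [Finset.mem_sdiff, Finset.mem_union] at this
    tauto
  have hSw : ∀ x : S, ∀ s ∈ T, s ≠ x.1 → w x.1 ∉ s := by
    intro x s hs hne hmem
    exact Finset.disjoint_left.1 (h.triDisj s hs x.1 (hS x.2) hne) hmem (hsee x).1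
  have hab : ∀ (a : {s // s ∈ T \ (S ∪ R)}) (b : S), Disjoint a.1 (insert (w b.1) (f b)) := by
    intro a b
    rw [Finset.disjoint_insert_right]
    refine ⟨hSw b _ (hmem a).1 ?_, h.triEdgeDisj _ (hmem a).1 _ (hfM b)⟩
    intro heq
    exact (hmem a).2.1 (heq ▸ b.2)
  have hbq : ∀ (b : S) (i : κ), Disjoint (insert (w b.1) (f b)) (Q i) := by
    intro b i
    rw [Finset.disjoint_insert_left]
    exact ⟨hQw i _ b.2, (hf b).2 i⟩
  have haq : ∀ (a : {s // s ∈ T \ (S ∪ R)}) (i : κ), Disjoint (Q i) a.1 := fun a i =>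
    hQT i _ (hmem a).1 (hmem a).2.1 (hmem a).2.2
  have hcard := h.card_le_of_indexed F (by
    rintro ((a | b) | i)
    · exact h.tri _ (hmem a).1
    · exact (h.edge _ (hfM b)).insert fun u hu => ((hsee b).2 u hu).symm
    · exact hQ i) (by
    rintro ((a | b) | i) ((a' | b') | i') hne
    · exact h.triDisj _ (hmem a).1 _ (hmem a').1 (by
        intro heq; exact hne (by rw [Subtype.ext heq]))
    · exact hab a b'
    · exact (haq a i').symm
    · exact (hab a' b).symm
    · have hbb : b ≠ b' := fun heq => hne (by rw [heq])
      have hbb' : b.1 ≠ b'.1 := fun heq => hbb (Subtype.ext heq)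
      have hne' : w b.1 ≠ w b'.1 := by
        intro heq
        exact hSw b' b.1 (hS b.2) hbb' (heq ▸ (hsee b).1)
      simp only [hFdef, Sum.elim_inl, Sum.elim_inr, Finset.disjoint_insert_left,
        Finset.disjoint_insert_right, Finset.mem_insert, not_or]
      refine ⟨⟨hne'.symm, ?_⟩, ?_, ?_⟩
      · exact Finset.disjoint_left.1 (h.triEdgeDisj _ (hS b'.2) _ (hfM b)) (hsee b').1
      · exact Finset.disjoint_left.1 (h.triEdgeDisj _ (hS b.2) _ (hfM b')) (hsee b).1
      · exact h.edgeDisj _ (hfM b) _ (hfM b') fun heq => hbb (hinj heq)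
    · exact hbq b i'
    · exact haq a' i
    · exact (hbq b' i).symm
    · exact hQd i i' fun heq => hne (by rw [heq]))
  simp only [Fintype.card_sum, Fintype.card_coe] at hcard
  rw [Finset.card_sdiff_of_subset (Finset.union_subset hS hR),
    Finset.card_union_of_disjoint hSR] at hcard
  have := Finset.card_le_card (Finset.union_subset hS hR)
  rw [Finset.card_union_of_disjoint hSR] at this
  omega

lemma false_of_exchange_one (h : IsTopTiling H T M I) {S : Finset (Finset (Fin n))}
    (w : Finset (Fin n) → Fin n) (hS : S ⊆ T)
    (hw : ∀ s ∈ S, ∀ e ∈ seers H M s, seesAt H e s (w s))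
    {q : Finset (Fin n)} (hq : H.IsNClique 3 q)
    (hqT : ∀ s ∈ T, s ∉ S → Disjoint q s) (hqw : ∀ s ∈ S, w s ∉ q)
    (hall : ∀ A ⊆ S, A.card ≤
      (A.biUnion fun s => (seers H M s).filter fun e => Disjoint e q).card) : False := by
  have := h.card_le_of_exchange (R := ∅) w hS (by simp) (by simp) hw (fun _ : Fin 1 => q)
    (fun _ => hq) (fun i j hij => absurd (Subsingleton.elim i j) hij)
    (fun _ s hs h1 _ => hqT s hs h1) (fun _ => hqw) (by simpa using hall)
  simp at this

lemma false_of_exchange_two (h : IsTopTiling H T M I) {S : Finset (Finset (Fin n))}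
    {r : Finset (Fin n)} (w : Finset (Fin n) → Fin n) (hS : S ⊆ T) (hr : r ∈ T) (hrS : r ∉ S)
    (hw : ∀ s ∈ S, ∀ e ∈ seers H M s, seesAt H e s (w s))
    {q q' : Finset (Fin n)} (hq : H.IsNClique 3 q) (hq' : H.IsNClique 3 q')
    (hqq : Disjoint q q')
    (hqT : ∀ s ∈ T, s ∉ S → s ≠ r → Disjoint q s ∧ Disjoint q' s)
    (hqw : ∀ s ∈ S, w s ∉ q ∧ w s ∉ q')
    (hall : ∀ A ⊆ S, A.card ≤
      (A.biUnion fun s => (seers H M s).filter fun e => Disjoint e q ∧ Disjoint e q').card) :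
    False := by
  have := h.card_le_of_exchange (R := {r}) w hS (by simpa using hr) (by simpa using hrS) hw
    ![q, q'] (by simpa [Fin.forall_fin_two] using ⟨hq, hq'⟩)
    (by simpa [Fin.forall_fin_two] using ⟨hqq, hqq.symm⟩)
    (by
      intro i s hs h1 h2
      have := hqT s hs h1 (by simpa using h2)
      fin_cases i
      · exact this.1
      · exact this.2)
    (by
      intro i s hs
      have := hqw s hs
      fin_cases i
      · exact this.1
      · exact this.2)
    (by simpa [Fin.forall_fin_two] using hall)
  simp at this

/-- Two edges of `M` that see a triangle of `T` see the same vertex. -/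
lemma seesAt_unique (h : IsTopTiling H T M I) {s e e' : Finset (Fin n)} {x y : Fin n}
    (hs : s ∈ T) (he : e ∈ M) (he' : e' ∈ M) (hne : e ≠ e') (hx : seesAt H e s x)
    (hy : seesAt H e' s y) : x = y := by
  by_contra hxy
  have hse := h.triEdgeDisj s hs
  have hdis : ∀ a ∈ s, ∀ f ∈ M, ∀ s' ∈ T, s' ∉ (∅ : Finset (Finset (Fin n))) → s' ≠ s →
      Disjoint (insert a f) s' := by
    intro a ha f hf s' hs' _ hne'
    rw [Finset.disjoint_insert_left]
    exact ⟨Finset.disjoint_left.1 (h.triDisj s hs s' hs' hne'.symm) ha,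
      (h.triEdgeDisj s' hs' f hf).symm⟩
  refine h.false_of_exchange_two (S := ∅) (fun _ => x) (by simp) hs (by simp) (by simp)
    (q := insert x e) (q' := insert y e')
    ((h.edge e he).insert fun u hu => (hx.2 u hu).symm)
    ((h.edge e' he').insert fun u hu => (hy.2 u hu).symm) ?_
    (fun s' hs' h1 h2 => ⟨hdis x hx.1 e he s' hs' h1 h2, hdis y hy.1 e' he' s' hs' h1 h2⟩)
    (by simp) (by
      intro A hA
      rw [Finset.subset_empty.1 hA]
      simp)
  simp only [Finset.disjoint_insert_left, Finset.disjoint_insert_right, Finset.mem_insert, not_or]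
  exact ⟨⟨Ne.symm hxy, Finset.disjoint_left.1 (hse e he) hy.1⟩,
    Finset.disjoint_left.1 (hse e' he') hx.1, h.edgeDisj e he e' he' hne⟩

/-- A triangle of `T` seen by at least two edges of `M` has a critical vertex. -/
lemma exists_critical (h : IsTopTiling H T M I) (hT : T.Nonempty) :
    ∃ w : Finset (Fin n) → Fin n, ∀ s ∈ T, 2 ≤ (seers H M s).card → w s ∈ s ∧
      (∀ e ∈ seers H M s, seesAt H e s (w s)) ∧
      ∀ e ∈ M, ∀ y, seesAt H e s y → y = w s := by
  classical
  obtain ⟨s₀, hs₀⟩ := hT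
  have hne : Nonempty (Fin n) := by
    have := (h.tri s₀ hs₀).card_eq
    obtain ⟨x, -⟩ := Finset.card_pos.1 (by omega : 0 < s₀.card)
    exact ⟨x⟩
  have : ∀ s, ∃ x, s ∈ T → 2 ≤ (seers H M s).card → x ∈ s ∧
      (∀ e ∈ seers H M s, seesAt H e s x) ∧ ∀ e ∈ M, ∀ y, seesAt H e s y → y = x := by
    intro s
    by_cases hs : s ∈ T ∧ 2 ≤ (seers H M s).card
    · obtain ⟨hs, hc⟩ := hs
      obtain ⟨e₁, h1, e₂, h2, h12⟩ := Finset.one_lt_card.1 hc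
      rw [mem_seers] at h1 h2
      obtain ⟨x₁, hx₁⟩ := h1.2
      obtain ⟨x₂, hx₂⟩ := h2.2
      have h3 := h.seesAt_unique hs h1.1 h2.1 h12 hx₁ hx₂
      subst h3
      have huniq : ∀ e ∈ M, ∀ y, seesAt H e s y → y = x₁ := by
        intro e he y hy
        by_cases hee : e = e₁
        · subst hee
          exact h.seesAt_unique hs he h2.1 h12 hy hx₂
        · exact h.seesAt_unique hs he h1.1 hee hy hx₁
      refine ⟨x₁, fun _ _ => ⟨hx₁.1, ?_, huniq⟩⟩
      intro e he
      rw [mem_seers] at he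
      obtain ⟨y, hy⟩ := he.2
      rw [← huniq e he.1 y hy]
      exact hy
    · exact ⟨hne.some, fun h1 h2 => absurd ⟨h1, h2⟩ hs⟩
  choose w hw using this
  exact ⟨w, hw⟩

end IsTopTiling

end Augmentation

section Counting

variable {n : ℕ} {H : SimpleGraph (Fin n)} {T M : Finset (Finset (Fin n))} {I : Finset (Fin n)}

lemma adjCount_singleton_lt {A : Finset (Fin n)} {u v : Fin n} (hu : u ∈ A)
    (huv : ¬ H.Adj u v) : adjCount H A {v} < A.card := by
  classical
  rw [adjCount_singleton]
  exact Finset.card_lt_card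
    (Finset.filter_ssubset.2 ⟨u, hu, huv⟩)

lemma adjCount_singleton_le (A : Finset (Fin n)) (v : Fin n) : adjCount H A {v} ≤ A.card := by
  simpa using adjCount_le_mul H A {v}

lemma card_le_card_biUnion_of_forall_card_le {α : Type*} [DecidableEq α]
    {S : Finset (Finset (Fin n))} {t : Finset (Fin n) → Finset α}
    (h : ∀ s ∈ S, S.card ≤ (t s).card) : ∀ A ⊆ S, A.card ≤ (A.biUnion t).card := by
  intro A hA
  rcases A.eq_empty_or_nonempty with rfl | ⟨s, hs⟩
  · simp
  · exact (Finset.card_le_card hA).trans ((h s (hA hs)).trans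
      (Finset.card_le_card (Finset.subset_biUnion_of_mem t hs)))

lemma SimpleGraph.IsNClique.insert_erase_three {s : Finset (Fin n)} (hs : H.IsNClique 3 s)
    {x v : Fin n} (hx : x ∈ s) (hv : ∀ y ∈ s.erase x, H.Adj y v) :
    H.IsNClique 3 (insert v (s.erase x)) :=
  (hs.erase_of_mem hx).insert fun y hy => (hv y hy).symm

/-- The function `w` assigns to every triangle of `T` seen by two edges of `M` its
critical vertex. -/
def IsCriticalChoice (H : SimpleGraph (Fin n)) (T M : Finset (Finset (Fin n)))
    (w : Finset (Fin n) → Fin n) : Prop :=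
  ∀ s ∈ T, 2 ≤ (seers H M s).card → w s ∈ s ∧
    (∀ e ∈ seers H M s, seesAt H e s (w s)) ∧ ∀ e ∈ M, ∀ y, seesAt H e s y → y = w s

namespace IsTopTiling

variable {w : Finset (Fin n) → Fin n}

lemma disjoint_edge_of_forall_mem (h : IsTopTiling H T M I) {e q : Finset (Fin n)} (he : e ∈ M)
    (hq : ∀ v ∈ q, (∃ s ∈ T, v ∈ s) ∨ v ∈ I) : Disjoint e q := by
  rw [Finset.disjoint_right]
  intro v hv
  rcases hq v hv with ⟨s, hs, hvs⟩ | hI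
  · exact Finset.disjoint_left.1 (h.triEdgeDisj s hs e he) hvs
  · exact (h.indepDisj v hI).2 e he

lemma notMem_of_ne (h : IsTopTiling H T M I) {s s' : Finset (Fin n)} {v : Fin n} (hs : s ∈ T)
    (hs' : s' ∈ T) (hne : s ≠ s') (hv : v ∈ s) : v ∉ s' :=
  Finset.disjoint_left.1 (h.triDisj s hs s' hs' hne) hv

lemma seers_filter_disjoint (h : IsTopTiling H T M I) {s q : Finset (Fin n)}
    (hq : ∀ v ∈ q, (∃ s ∈ T, v ∈ s) ∨ v ∈ I) :
    (seers H M s).filter (fun e => Disjoint e q) = seers H M s :=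
  Finset.filter_true_of_mem fun _ he => h.disjoint_edge_of_forall_mem (mem_seers.1 he).1 hq

/-- A non-critical vertex is not adjacent to both non-critical vertices of another triangle. -/
lemma exists_not_adj_of_noncritical (h : IsTopTiling H T M I) (hw : IsCriticalChoice H T M w)
    {s s' : Finset (Fin n)} (hs : s ∈ T) (hs' : s' ∈ T) (hne : s ≠ s')
    (hc : 2 ≤ (seers H M s).card) (hc' : 2 ≤ (seers H M s').card) {v : Fin n} (hv : v ∈ s')
    (hvw : v ≠ w s') : ∃ y ∈ s.erase (w s), ¬ H.Adj y v := by
  by_contra! hadj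
  obtain ⟨hws, hs1, -⟩ := hw s hs hc
  obtain ⟨hws', hs1', -⟩ := hw s' hs' hc'
  have hq : ∀ y ∈ insert v (s.erase (w s)), y ∈ s ∨ y ∈ s' := by
    intro y hy
    simp only [Finset.mem_insert, Finset.mem_erase] at hy
    rcases hy with rfl | hy
    · exact Or.inr hv
    · exact Or.inl hy.2
  refine h.false_of_exchange_one (S := {s, s'}) w ?_ ?_
    ((h.tri s hs).insert_erase_three hws hadj) ?_ ?_ ?_
  · simp [Finset.insert_subset_iff, hs, hs']
  · simp only [Finset.mem_insert, Finset.mem_singleton]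
    rintro t (rfl | rfl)
    · exact hs1
    · exact hs1'
  · intro t ht hne'
    simp only [Finset.mem_insert, Finset.mem_singleton, not_or] at hne'
    rw [Finset.disjoint_left]
    intro y hy
    rcases hq y hy with hy | hy
    · exact h.notMem_of_ne hs ht (Ne.symm hne'.1) hy
    · exact h.notMem_of_ne hs' ht (Ne.symm hne'.2) hy
  · simp only [Finset.mem_insert, Finset.mem_singleton, Finset.mem_erase]
    rintro t (rfl | rfl)
    · rintro (heq | h1)
      · exact h.notMem_of_ne hs' hs hne.symm hv (heq ▸ hws)
      · exact h1.1 rfl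
    · rintro (heq | h1)
      · exact hvw heq.symm
      · exact h.notMem_of_ne hs' hs hne.symm hws' h1.2
  · apply card_le_card_biUnion_of_forall_card_le
    simp only [Finset.mem_insert, Finset.mem_singleton]
    rintro t (rfl | rfl) <;>
    · rw [h.seers_filter_disjoint, Finset.card_pair hne]
      · assumption
      · intro y hy
        rcases hq y (by simpa using hy) with h1 | h1
        · exact Or.inl ⟨_, hs, h1⟩
        · exact Or.inl ⟨_, hs', h1⟩

lemma exists_not_adj_of_indep (h : IsTopTiling H T M I) (hw : IsCriticalChoice H T M w)
    {s : Finset (Fin n)} (hs : s ∈ T) (hc : 2 ≤ (seers H M s).card) {p : Fin n} (hp : p ∈ I) :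
    ∃ y ∈ s.erase (w s), ¬ H.Adj y p := by
  by_contra! hadj
  obtain ⟨hws, hs1, -⟩ := hw s hs hc
  have hq : ∀ y ∈ insert p (s.erase (w s)), y = p ∨ y ∈ s := by
    intro y hy
    simp only [Finset.mem_insert, Finset.mem_erase] at hy
    tauto
  refine h.false_of_exchange_one (S := {s}) w ?_ ?_
    ((h.tri s hs).insert_erase_three hws hadj) ?_ ?_ ?_
  · simpa using hs
  · simpa using hs1
  · intro t ht hne'
    simp only [Finset.mem_singleton] at hne'
    rw [Finset.disjoint_left]
    intro y hy
    rcases hq y hy with rfl | hy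
    · exact (h.indepDisj _ hp).1 t ht
    · exact h.notMem_of_ne hs ht (Ne.symm hne') hy
  · simp only [Finset.mem_insert, Finset.mem_singleton, Finset.mem_erase]
    rintro t rfl
    rintro (heq | h1)
    · exact (h.indepDisj _ hp).1 _ hs (heq ▸ hws)
    · exact h1.1 rfl
  · apply card_le_card_biUnion_of_forall_card_le
    simp only [Finset.mem_singleton]
    rintro t rfl
    rw [h.seers_filter_disjoint, Finset.card_singleton]
    · omega
    · intro y hy
      rcases hq y hy with rfl | h1
      · exact Or.inr hp
      · exact Or.inl ⟨_, hs, h1⟩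

lemma false_of_two_opposite (h : IsTopTiling H T M I) (hw : IsCriticalChoice H T M w)
    {s s' u : Finset (Fin n)} (hs : s ∈ T) (hs' : s' ∈ T) (hu : u ∈ T) (hne : s ≠ s')
    (hsu : s ≠ u) (hsu' : s' ≠ u) (hc : 2 ≤ (seers H M s).card)
    (hc' : 2 ≤ (seers H M s').card) {v v' : Fin n} (hv : v ∈ u) (hv' : v' ∈ u) (hvv : v ≠ v')
    (hadj : ∀ y ∈ s.erase (w s), H.Adj y v) (hadj' : ∀ y ∈ s'.erase (w s'), H.Adj y v') :
    False := by
  obtain ⟨hws, hs1, -⟩ := hw s hs hc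
  obtain ⟨hws', hs1', -⟩ := hw s' hs' hc'
  have hq : ∀ y ∈ insert v (s.erase (w s)), y ∈ s ∨ y ∈ u := by
    intro y hy
    simp only [Finset.mem_insert, Finset.mem_erase] at hy
    rcases hy with rfl | hy
    · exact Or.inr hv
    · exact Or.inl hy.2
  have hq' : ∀ y ∈ insert v' (s'.erase (w s')), y ∈ s' ∨ y ∈ u := by
    intro y hy
    simp only [Finset.mem_insert, Finset.mem_erase] at hy
    rcases hy with rfl | hy
    · exact Or.inr hv'
    · exact Or.inl hy.2
  refine h.false_of_exchange_two (S := {s, s'}) (r := u) w ?_ hu ?_ ?_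
    ((h.tri s hs).insert_erase_three hws hadj) ((h.tri s' hs').insert_erase_three hws' hadj')
    ?_ ?_ ?_ ?_
  · simp [Finset.insert_subset_iff, hs, hs']
  · simp [hsu.symm, hsu'.symm]
  · simp only [Finset.mem_insert, Finset.mem_singleton]
    rintro t (rfl | rfl)
    · exact hs1
    · exact hs1'
  · have hvs : v ∉ s' := h.notMem_of_ne hu hs' hsu'.symm hv
    have hvs' : v' ∉ s := h.notMem_of_ne hu hs hsu.symm hv'
    have hd := Finset.disjoint_left.1 (h.triDisj s hs s' hs' hne)
    rw [Finset.disjoint_left]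
    simp only [Finset.mem_insert, Finset.mem_erase]
    rintro y (rfl | h1) (rfl | h2)
    · exact hvv rfl
    · exact hvs h2.2
    · exact hvs' h1.2
    · exact hd h1.2 h2.2
  · intro t ht hne' htu
    simp only [Finset.mem_insert, Finset.mem_singleton, not_or] at hne'
    rw [Finset.disjoint_left, Finset.disjoint_left]
    refine ⟨fun y hy => ?_, fun y hy => ?_⟩
    · rcases hq y hy with hy | hy
      · exact h.notMem_of_ne hs ht (Ne.symm hne'.1) hy
      · exact h.notMem_of_ne hu ht (Ne.symm htu) hy
    · rcases hq' y hy with hy | hy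
      · exact h.notMem_of_ne hs' ht (Ne.symm hne'.2) hy
      · exact h.notMem_of_ne hu ht (Ne.symm htu) hy
  · have h1 := h.notMem_of_ne hs hu hsu hws
    have h2 := h.notMem_of_ne hs' hu hsu' hws'
    have h3 := h.notMem_of_ne hs hs' hne hws
    have h4 := h.notMem_of_ne hs' hs hne.symm hws'
    simp only [Finset.mem_insert, Finset.mem_singleton, Finset.mem_erase]
    rintro t (rfl | rfl)
    · exact ⟨by rintro (heq | h5); exacts [h1 (heq ▸ hv), h5.1 rfl],
        by rintro (heq | h5); exacts [h1 (heq ▸ hv'), h3 h5.2]⟩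
    · exact ⟨by rintro (heq | h5); exacts [h2 (heq ▸ hv), h4 h5.2],
        by rintro (heq | h5); exacts [h2 (heq ▸ hv'), h5.1 rfl]⟩
  · apply card_le_card_biUnion_of_forall_card_le
    simp only [Finset.mem_insert, Finset.mem_singleton]
    have hd : ∀ e ∈ M, Disjoint e (insert v (s.erase (w s))) ∧
        Disjoint e (insert v' (s'.erase (w s'))) := by
      intro e he
      refine ⟨h.disjoint_edge_of_forall_mem he fun y hy => ?_,
        h.disjoint_edge_of_forall_mem he fun y hy => ?_⟩
      · rcases hq y hy with h1 | h1
        exacts [Or.inl ⟨_, hs, h1⟩, Or.inl ⟨_, hu, h1⟩]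
      · rcases hq' y hy with h1 | h1
        exacts [Or.inl ⟨_, hs', h1⟩, Or.inl ⟨_, hu, h1⟩]
    rintro t (rfl | rfl) <;>
    · rw [Finset.filter_true_of_mem fun e he => hd e (mem_seers.1 he).1, Finset.card_pair hne]
      assumption

lemma adjCount_singleton_le_two (h : IsTopTiling H T M I) {s : Finset (Fin n)} (hs : s ∈ T)
    {x v : Fin n} (hx : ∃ y ∈ s.erase x, ¬ H.Adj y v) : adjCount H s {v} ≤ 2 := by
  obtain ⟨y, hy, hyv⟩ := hx
  have := adjCount_singleton_lt (Finset.mem_of_mem_erase hy) hyv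
  rw [(h.tri s hs).card_eq] at this
  omega

lemma adjCount_singleton_le_three (h : IsTopTiling H T M I) {s : Finset (Fin n)} (hs : s ∈ T)
    (v : Fin n) : adjCount H s {v} ≤ 3 := by
  have := adjCount_singleton_le (H := H) s v
  rwa [(h.tri s hs).card_eq] at this

lemma adjCount_le_seven (h : IsTopTiling H T M I) (hw : IsCriticalChoice H T M w)
    {s s' : Finset (Fin n)} (hs : s ∈ T) (hs' : s' ∈ T) (hne : s ≠ s')
    (hc : 2 ≤ (seers H M s).card) (hc' : 2 ≤ (seers H M s').card) : adjCount H s s' ≤ 7 := by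
  rw [adjCount_eq_sum_right]
  calc _ ≤ ∑ v ∈ s', (2 + if v = w s' then 1 else 0) := by
        refine Finset.sum_le_sum fun v hv => ?_
        split_ifs with hvw
        · exact h.adjCount_singleton_le_three hs v
        · exact h.adjCount_singleton_le_two hs
            (h.exists_not_adj_of_noncritical hw hs hs' hne hc hc' hv hvw)
    _ ≤ 7 := by
        rw [Finset.sum_add_distrib, Finset.sum_ite_eq' s' (w s')]
        simp [(h.tri s' hs').card_eq, (hw s' hs' hc').1]

lemma adjCount_le_six (h : IsTopTiling H T M I) (hw : IsCriticalChoice H T M w)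
    {s s' : Finset (Fin n)} (hs : s ∈ T) (hs' : s' ∈ T) (hne : s ≠ s')
    (hc : 2 ≤ (seers H M s).card) (hc' : 2 ≤ (seers H M s').card)
    (hx : ∃ y ∈ s.erase (w s), ¬ H.Adj y (w s')) : adjCount H s s' ≤ 6 := by
  rw [adjCount_eq_sum_right]
  calc _ ≤ ∑ v ∈ s', 2 := by
        refine Finset.sum_le_sum fun v hv => ?_
        by_cases hvw : v = w s'
        · exact h.adjCount_singleton_le_two hs (hvw ▸ hx)
        · exact h.adjCount_singleton_le_two hs
            (h.exists_not_adj_of_noncritical hw hs hs' hne hc hc' hv hvw)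
    _ ≤ 6 := by simp [(h.tri s' hs').card_eq]

lemma adjCount_le_nine (h : IsTopTiling H T M I) {s s' : Finset (Fin n)} (hs : s ∈ T)
    (hs' : s' ∈ T) : adjCount H s s' ≤ 9 := by
  have := adjCount_le_mul H s s'
  rwa [(h.tri s hs).card_eq, (h.tri s' hs').card_eq] at this

lemma adjCount_self (h : IsTopTiling H T M I) {s : Finset (Fin n)} (hs : s ∈ T) :
    adjCount H s s ≤ 6 := by
  rw [adjCount_eq_sum_right]
  calc _ ≤ ∑ v ∈ s, 2 := by
        refine Finset.sum_le_sum fun v hv => ?_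
        have := adjCount_singleton_lt hv (H.irrefl (v := v))
        rw [(h.tri s hs).card_eq] at this
        omega
    _ ≤ 6 := by simp [(h.tri s hs).card_eq]

/-- Only one triangle seen by two edges of `M` can send more than seven edges to a given
triangle of `T`. -/
lemma sum_adjCount_le (h : IsTopTiling H T M I) (hw : IsCriticalChoice H T M w)
    {L : Finset (Finset (Fin n))} (hL : ∀ s ∈ L, s ∈ T ∧ 2 ≤ (seers H M s).card)
    {u : Finset (Fin n)} (hu : u ∈ T) (huL : u ∉ L) :
    ∑ s ∈ L, adjCount H s u ≤ 7 * L.card + 2 := by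
  classical
  have hopp : ∀ s ∈ L, 8 ≤ adjCount H s u →
      2 ≤ (u.filter fun v => ∀ y ∈ s.erase (w s), H.Adj y v).card := by
    intro s hs h8
    have : adjCount H s u ≤ 6 + (u.filter fun v => ∀ y ∈ s.erase (w s), H.Adj y v).card := by
      rw [adjCount_eq_sum_right]
      calc _ ≤ ∑ v ∈ u, (2 + if ∀ y ∈ s.erase (w s), H.Adj y v then 1 else 0) := by
            refine Finset.sum_le_sum fun v hv => ?_
            split_ifs with hvw
            · exact h.adjCount_singleton_le_three (hL s hs).1 v
            · push Not at hvw
              exact h.adjCount_singleton_le_two (hL s hs).1 hvw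
        _ = _ := by
            rw [Finset.sum_add_distrib, Finset.card_filter]
            simp [(h.tri u hu).card_eq]
    omega
  have hone : (L.filter fun s => 8 ≤ adjCount H s u).card ≤ 1 := by
    rw [Finset.card_le_one]
    intro s hs s' hs'
    rw [Finset.mem_filter] at hs hs'
    by_contra hne
    have h1 := hopp s hs.1 hs.2
    have h2 := hopp s' hs'.1 hs'.2
    obtain ⟨v, hv⟩ := Finset.card_pos.1 (by omega :
      0 < (u.filter fun v => ∀ y ∈ s.erase (w s), H.Adj y v).card)
    obtain ⟨v', hv', hvv⟩ := Finset.exists_mem_ne (by omega :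
      1 < (u.filter fun v => ∀ y ∈ s'.erase (w s'), H.Adj y v).card) v
    rw [Finset.mem_filter] at hv hv'
    exact h.false_of_two_opposite hw (hL s hs.1).1 (hL s' hs'.1).1 hu hne
      (fun heq => huL (heq ▸ hs.1)) (fun heq => huL (heq ▸ hs'.1)) (hL s hs.1).2
      (hL s' hs'.1).2 hv.1 hv'.1 hvv.symm hv.2 hv'.2
  calc _ ≤ ∑ s ∈ L, (7 + if 8 ≤ adjCount H s u then 2 else 0) := by
        refine Finset.sum_le_sum fun s hs => ?_
        split_ifs
        · exact h.adjCount_le_nine (hL s hs).1 hu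
        · omega
    _ = 7 * L.card + 2 * (L.filter fun s => 8 ≤ adjCount H s u).card := by
        rw [Finset.sum_add_distrib, ← Finset.sum_filter]
        simp [mul_comm]
    _ ≤ _ := by omega

lemma adjCount_edge_le_three (h : IsTopTiling H T M I) {s e : Finset (Fin n)} (hs : s ∈ T)
    (he : e ∈ M) (hse : ¬ sees H e s) : adjCount H s e ≤ 3 := by
  rw [adjCount_comm, adjCount_eq_sum_right]
  calc _ ≤ ∑ v ∈ s, 1 := by
        refine Finset.sum_le_sum fun v hv => ?_
        have : ∃ u ∈ e, ¬ H.Adj u v := by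
          by_contra! hc
          exact hse ⟨v, hv, hc⟩
        obtain ⟨u, hu, huv⟩ := this
        have := adjCount_singleton_lt hu huv
        rw [(h.edge e he).card_eq] at this
        omega
    _ ≤ 3 := by simp [(h.tri s hs).card_eq]

lemma adjCount_edge_le_four (h : IsTopTiling H T M I) (hw : IsCriticalChoice H T M w)
    {s e : Finset (Fin n)} (hs : s ∈ T) (he : e ∈ M) (hc : 2 ≤ (seers H M s).card) :
    adjCount H s e ≤ 4 := by
  rw [adjCount_comm, adjCount_eq_sum_right]
  calc _ ≤ ∑ v ∈ s, (1 + if v = w s then 1 else 0) := by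
        refine Finset.sum_le_sum fun v hv => ?_
        split_ifs with hvw
        · have := adjCount_singleton_le (H := H) e v
          rwa [(h.edge e he).card_eq] at this
        · have : ∃ u ∈ e, ¬ H.Adj u v := by
            by_contra! hadj
            exact hvw ((hw s hs hc).2.2 e he v ⟨hv, hadj⟩)
          obtain ⟨u, hu, huv⟩ := this
          have := adjCount_singleton_lt hu huv
          rw [(h.edge e he).card_eq] at this
          omega
    _ ≤ 4 := by
        rw [Finset.sum_add_distrib, Finset.sum_ite_eq' s (w s)]
        simp [(h.tri s hs).card_eq, (hw s hs hc).1]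

lemma adjCount_rest (h : IsTopTiling H T M I) (s : Finset (Fin n)) :
    adjCount H s (M.biUnion id ∪ I) = ∑ e ∈ M, adjCount H s e + ∑ p ∈ I, adjCount H s {p} := by
  rw [adjCount_union_right, adjCount_biUnion_right, ← adjCount_eq_sum_right]
  · intro e he e' he' hne
    exact h.edgeDisj e he e' he' hne
  · rw [Finset.disjoint_left]
    intro v hv hvI
    obtain ⟨e, he, hve⟩ := Finset.mem_biUnion.1 hv
    exact (h.indepDisj v hvI).2 e he hve

lemma sum_edge_le (h : IsTopTiling H T M I) {s : Finset (Fin n)} (hs : s ∈ T) (c : ℕ)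
    (hc : ∀ e ∈ seers H M s, adjCount H s e ≤ 3 + c) :
    ∑ e ∈ M, adjCount H s e ≤ 3 * M.card + c * (seers H M s).card := by
  classical
  calc _ ≤ ∑ e ∈ M, (3 + if sees H e s then c else 0) := by
        refine Finset.sum_le_sum fun e he => ?_
        split_ifs with hse
        · exact hc e (mem_seers.2 ⟨he, hse⟩)
        · exact h.adjCount_edge_le_three hs he hse
    _ = _ := by
        rw [Finset.sum_add_distrib, ← Finset.sum_filter]
        simp only [Finset.sum_const, smul_eq_mul, seers]
        rw [mul_comm, mul_comm c]

/-- A triangle seen by at least two edges of `M` sends few edges to the rest. -/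
lemma adjCount_rest_le (h : IsTopTiling H T M I) (hw : IsCriticalChoice H T M w)
    {s : Finset (Fin n)} (hs : s ∈ T) (hc : 2 ≤ (seers H M s).card) :
    adjCount H s (M.biUnion id ∪ I) ≤ 3 * M.card + (seers H M s).card + 2 * I.card := by
  rw [h.adjCount_rest]
  have h1 := h.sum_edge_le hs 1 fun e he => h.adjCount_edge_le_four hw hs (mem_seers.1 he).1 hc
  have h2 : ∑ p ∈ I, adjCount H s {p} ≤ ∑ p ∈ I, 2 := Finset.sum_le_sum fun p hp =>
    h.adjCount_singleton_le_two hs (h.exists_not_adj_of_indep hw hs hc hp)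
  simp only [Finset.sum_const, smul_eq_mul] at h2
  omega

/-- A triangle seen by at most two edges of `M` sends few edges to the rest. -/
lemma adjCount_rest_le_of_card_seers_le_two (h : IsTopTiling H T M I)
    (hw : IsCriticalChoice H T M w) {s : Finset (Fin n)} (hs : s ∈ T)
    (hc : (seers H M s).card ≤ 2) :
    adjCount H s (M.biUnion id ∪ I) ≤ 3 * M.card + 3 + 3 * I.card := by
  by_cases hc2 : 2 ≤ (seers H M s).card
  · have := h.adjCount_rest_le hw hs hc2
    omega
  · rw [h.adjCount_rest]
    have h1 := h.sum_edge_le hs 3 fun e he => by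
      have := adjCount_le_mul H s e
      rwa [(h.tri s hs).card_eq, (h.edge e (mem_seers.1 he).1).card_eq] at this
    have h2 : ∑ p ∈ I, adjCount H s {p} ≤ ∑ p ∈ I, 3 := Finset.sum_le_sum fun p hp =>
      h.adjCount_singleton_le_three hs p
    simp only [Finset.sum_const, smul_eq_mul] at h2
    omega

/-- The number of edges inside the triangles of the tiling, when all but at most two of
them are seen by two edges of `M`, and the triangles in `G` send at most six edges to `s₀`. -/
lemma sum_sum_adjCount_le (h : IsTopTiling H T M I) (hw : IsCriticalChoice H T M w)
    {L U G : Finset (Finset (Fin n))} (hLU : Disjoint L U) (hT : L ∪ U = T)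
    (hL : ∀ s ∈ L, 2 ≤ (seers H M s).card) (hU : U.card ≤ 2) {s₀ : Finset (Fin n)}
    (hG : G ⊆ L.erase s₀) (hs₀ : G.Nonempty → s₀ ∈ L)
    (hG6 : ∀ s ∈ G, adjCount H s s₀ ≤ 6) :
    ∑ s ∈ T, ∑ s' ∈ T, adjCount H s s' + 2 * G.card + T.card ≤ 7 * T.card ^ 2 + 18 := by
  classical
  have hLT : ∀ s ∈ L, s ∈ T := fun s hs => hT ▸ Finset.mem_union_left _ hs
  have hUT : ∀ s ∈ U, s ∈ T := fun s hs => hT ▸ Finset.mem_union_right _ hs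
  have hGL : G ⊆ L := hG.trans (Finset.erase_subset _ _)
  have hLL : ∑ s ∈ L, ∑ s' ∈ L, adjCount H s s' + 2 * G.card + L.card ≤ 7 * L.card ^ 2 := by
    have hpt : ∑ s ∈ L, ∑ s' ∈ L, (adjCount H s s' + (if s = s' then 1 else 0)
        + (if s ∈ G then (if s' = s₀ then 1 else 0) else 0)
        + (if s = s₀ then (if s' ∈ G then 1 else 0) else 0)) ≤ ∑ s ∈ L, ∑ s' ∈ L, 7 := by
      refine Finset.sum_le_sum fun s hs => Finset.sum_le_sum fun s' hs' => ?_
      have hG0 : s₀ ∉ G := fun h0 => Finset.notMem_erase _ _ (hG h0)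
      by_cases hss : s = s'
      · subst hss
        have := h.adjCount_self (hLT s hs)
        have h1 : s ∈ G → s ≠ s₀ := fun h1 h2 => hG0 (h2 ▸ h1)
        split_ifs <;> first | omega | (exfalso; tauto)
      · have h7 := h.adjCount_le_seven hw (hLT s hs) (hLT s' hs') hss (hL s hs) (hL s' hs')
        by_cases h1 : s ∈ G ∧ s' = s₀
        · have h6 := hG6 s h1.1
          rw [← h1.2] at h6
          have h2 : s ≠ s₀ := fun h2 => hG0 (h2 ▸ h1.1)
          simp only [hss, h2, h1.1, if_true, if_false]
          split_ifs <;> omega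
        · by_cases h2 : s' ∈ G ∧ s = s₀
          · have h6 := hG6 s' h2.1
            rw [← h2.2, adjCount_comm] at h6
            have h3 : s ∉ G := fun h3 => hG0 (h2.2 ▸ h3)
            simp only [hss, h2.1, h3, if_true, if_false]
            split_ifs <;> omega
          · split_ifs <;> first | omega | (exfalso; tauto)
    simp only [Finset.sum_add_distrib] at hpt
    have e1 : ∑ s ∈ L, ∑ s' ∈ L, (if s = s' then 1 else 0) = L.card := by
      simp
    have e2 : ∑ s ∈ L, ∑ s' ∈ L, (if s ∈ G then (if s' = s₀ then 1 else 0) else 0) = G.card := by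
      rcases G.eq_empty_or_nonempty with rfl | hne
      · simp
      · have h1 : ∀ s, ∑ s' ∈ L, (if s ∈ G then (if s' = s₀ then 1 else 0) else 0)
            = if s ∈ G then 1 else 0 := by
          intro s
          split_ifs <;> simp [hs₀ hne]
        simp only [h1]
        rw [← Finset.card_filter, Finset.filter_mem_eq_inter, Finset.inter_eq_right.2 hGL]
    have e3 : ∑ s ∈ L, ∑ s' ∈ L, (if s = s₀ then (if s' ∈ G then 1 else 0) else 0) = G.card := by
      rw [Finset.sum_comm, ← e2]
      refine Finset.sum_congr rfl fun s _ => Finset.sum_congr rfl fun s' _ => ?_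
      split_ifs <;> rfl
    rw [e1, e2, e3] at hpt
    simp only [Finset.sum_const, smul_eq_mul] at hpt
    nlinarith
  have hLUsum : ∑ u ∈ U, ∑ s ∈ L, adjCount H s u ≤ U.card * (7 * L.card + 2) := by
    rw [← smul_eq_mul]
    refine Finset.sum_le_card_nsmul _ _ _ fun u hu => ?_
    exact h.sum_adjCount_le hw (fun s hs => ⟨hLT s hs, hL s hs⟩) (hUT u hu)
      (Finset.disjoint_right.1 hLU hu)
  have hULsum : ∑ u ∈ U, ∑ s ∈ L, adjCount H u s ≤ U.card * (7 * L.card + 2) := by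
    simpa only [adjCount_comm] using hLUsum
  have hUU : ∑ u ∈ U, ∑ s ∈ U, adjCount H u s ≤ U.card * (U.card * 9) := by
    rw [← smul_eq_mul]
    refine Finset.sum_le_card_nsmul _ _ _ fun u hu => ?_
    rw [← smul_eq_mul]
    exact Finset.sum_le_card_nsmul _ _ _ fun s hs => h.adjCount_le_nine (hUT u hu) (hUT s hs)
  have hcard : T.card = L.card + U.card := by
    rw [← hT, Finset.card_union_of_disjoint hLU]
  have hsplit : ∑ s ∈ T, ∑ s' ∈ T, adjCount H s s'
      = ∑ s ∈ L, ∑ s' ∈ L, adjCount H s s' + ∑ u ∈ U, ∑ s ∈ L, adjCount H s u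
        + (∑ u ∈ U, ∑ s ∈ L, adjCount H u s + ∑ u ∈ U, ∑ s ∈ U, adjCount H u s) := by
    rw [← hT]
    simp only [Finset.sum_union hLU, Finset.sum_add_distrib]
    rw [Finset.sum_comm (s := L) (t := U)]
  rw [hsplit, hcard]
  nlinarith

end IsTopTiling

end Counting

section Exchange

variable {n : ℕ} {H : SimpleGraph (Fin n)} {T M : Finset (Finset (Fin n))} {I : Finset (Fin n)}

lemma card_le_card_biUnion_of_exceptional {α : Type*} [DecidableEq α]
    {S : Finset (Finset (Fin n))} {t : Finset (Fin n) → Finset α} (s₁ : Finset (Fin n))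
    (h : ∀ s ∈ S, s ≠ s₁ → S.card ≤ (t s).card) (h₁ : s₁ ∈ S → 1 ≤ (t s₁).card) :
    ∀ A ⊆ S, A.card ≤ (A.biUnion t).card := by
  intro A hA
  by_cases hex : ∃ s ∈ A, s ≠ s₁
  · obtain ⟨s, hs, hne⟩ := hex
    exact (Finset.card_le_card hA).trans ((h s (hA hs) hne).trans
      (Finset.card_le_card (Finset.subset_biUnion_of_mem t hs)))
  · push Not at hex
    have hA1 : A ⊆ {s₁} := fun s hs => Finset.mem_singleton.2 (hex s hs)
    rcases Finset.subset_singleton_iff.1 hA1 with rfl | rfl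
    · simp
    · simpa using h₁ (hA (Finset.mem_singleton_self _))

lemma card_le_of_forall_not_disjoint {F : Finset (Finset (Fin n))} {q : Finset (Fin n)}
    (hF : (F : Set (Finset (Fin n))).Pairwise fun s₁ s₂ => Disjoint s₁ s₂)
    (hq : ∀ s ∈ F, ¬ Disjoint q s) : F.card ≤ q.card := by
  classical
  calc F.card = ∑ s ∈ F, 1 := by simp
    _ ≤ ∑ s ∈ F, (q ∩ s).card := Finset.sum_le_sum fun s hs => by
        rw [Nat.one_le_iff_ne_zero, Ne, Finset.card_eq_zero, ← Finset.disjoint_iff_inter_eq_empty]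
        exact hq s hs
    _ = (F.biUnion fun s => q ∩ s).card := by
        rw [Finset.card_biUnion]
        intro s hs s' hs' hne
        exact (hF hs hs' hne).mono Finset.inter_subset_right Finset.inter_subset_right
    _ ≤ q.card := Finset.card_le_card (Finset.biUnion_subset.2 fun s _ => Finset.inter_subset_left)

/-- The members of `F` meeting `q`. -/
def meeting (F : Finset (Finset (Fin n))) (q : Finset (Fin n)) : Finset (Finset (Fin n)) :=
  F.filter fun s => ¬ Disjoint q s

/-- Every vertex of `q` lies in an edge of `M` or is a non-critical vertex of a triangle of `T`
seen by at least two edges of `M`. -/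
def IsLocated (H : SimpleGraph (Fin n)) (T M : Finset (Finset (Fin n)))
    (w : Finset (Fin n) → Fin n) (q : Finset (Fin n)) : Prop :=
  ∀ v ∈ q, (∃ e ∈ M, v ∈ e) ∨ ∃ s ∈ T, 2 ≤ (seers H M s).card ∧ v ∈ s ∧ v ≠ w s

namespace IsTopTiling

variable {w : Finset (Fin n) → Fin n} {q : Finset (Fin n)}

lemma pairwise_disjoint_union (h : IsTopTiling H T M I) :
    ((T ∪ M : Finset (Finset (Fin n))) : Set (Finset (Fin n))).Pairwise
      fun s₁ s₂ => Disjoint s₁ s₂ := by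
  intro s hs s' hs' hne
  simp only [Finset.coe_union, Set.mem_union, Finset.mem_coe] at hs hs'
  rcases hs with hs | hs <;> rcases hs' with hs' | hs'
  · exact h.triDisj s hs s' hs' hne
  · exact h.triEdgeDisj s hs s' hs'
  · exact (h.triEdgeDisj s' hs' s hs).symm
  · exact h.edgeDisj s hs s' hs' hne

lemma card_meeting_add_le (h : IsTopTiling H T M I) (hq : H.IsNClique 3 q) :
    (meeting T q).card + (meeting M q).card ≤ 3 := by
  rw [← hq.card_eq, ← Finset.card_union_of_disjoint]
  · refine card_le_of_forall_not_disjoint (h.pairwise_disjoint_union.mono ?_) ?_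
    · exact_mod_cast Finset.union_subset_union (Finset.filter_subset _ _)
        (Finset.filter_subset _ _)
    · intro s hs
      rcases Finset.mem_union.1 hs with hs | hs <;> exact (Finset.mem_filter.1 hs).2
  · rw [Finset.disjoint_left]
    intro s hs hs'
    have := h.triEdgeDisj s (Finset.mem_filter.1 hs).1 s (Finset.mem_filter.1 hs').1
    rw [disjoint_self] at this
    exact (Finset.mem_filter.1 hs).2 (this ▸ disjoint_bot_right)

lemma card_seers_le (s : Finset (Fin n)) :
    (seers H M s).card ≤ ((seers H M s).filter fun e => Disjoint e q).card
      + (meeting M q).card := by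
  rw [← Finset.card_filter_add_card_filter_not (s := seers H M s) fun e => Disjoint e q]
  gcongr
  intro e he
  obtain ⟨he, hd⟩ := Finset.mem_filter.1 he
  exact Finset.mem_filter.2 ⟨(mem_seers.1 he).1, fun hc => hd hc.symm⟩

lemma two_le_card_seers_of_mem_meeting (h : IsTopTiling H T M I) (hw : IsCriticalChoice H T M w)
    (hloc : IsLocated H T M w q) {s : Finset (Fin n)} (hs : s ∈ meeting T q) :
    2 ≤ (seers H M s).card ∧ w s ∉ q := by
  obtain ⟨hs, hd⟩ := Finset.mem_filter.1 hs
  have key : ∀ v ∈ q, v ∈ s → 2 ≤ (seers H M s).card ∧ v ≠ w s := by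
    intro v hv hvs
    rcases hloc v hv with ⟨e, he, hve⟩ | ⟨s', hs', hc, hvs', hvw⟩
    · exact absurd hve (Finset.disjoint_left.1 (h.triEdgeDisj s hs e he) hvs)
    · by_cases hss : s = s'
      · subst hss; exact ⟨hc, hvw⟩
      · exact absurd hvs' (h.notMem_of_ne hs hs' hss hvs)
  obtain ⟨v, hv, hvs⟩ := Finset.not_disjoint_iff.1 hd
  obtain ⟨hc, -⟩ := key v hv hvs
  exact ⟨hc, fun hwq => (key _ hwq (hw s hs hc).1).2 rfl⟩

/-- If all triangles meeting `q`, with one exception, are seen by three edges of `M`, and the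
exceptional one is seen by an edge disjoint from `q`, then the tiling can be augmented. -/
lemma false_of_three_le_card_seers (h : IsTopTiling H T M I) (hw : IsCriticalChoice H T M w)
    (hq : H.IsNClique 3 q) (hloc : IsLocated H T M w q) (s₁ : Finset (Fin n))
    (hgood : ∀ s ∈ meeting T q, s ≠ s₁ → 3 ≤ (seers H M s).card)
    (hs₁ : s₁ ∈ meeting T q → ∃ e ∈ seers H M s₁, Disjoint e q) : False := by
  refine h.false_of_exchange_one w (Finset.filter_subset _ _) ?_ hq ?_ ?_
    (card_le_card_biUnion_of_exceptional s₁ ?_ ?_) (S := meeting T q)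
  · intro s hs
    exact (hw s (Finset.mem_filter.1 hs).1
      (h.two_le_card_seers_of_mem_meeting hw hloc hs).1).2.1
  · intro s hs hns
    by_contra hd
    exact hns (Finset.mem_filter.2 ⟨hs, hd⟩)
  · exact fun s hs => (h.two_le_card_seers_of_mem_meeting hw hloc hs).2
  · intro s hs hne
    have h1 := hgood s hs hne
    have h2 := h.card_meeting_add_le hq
    have h3 := card_seers_le (H := H) (M := M) (q := q) s
    omega
  · intro hs
    obtain ⟨e, he, hd⟩ := hs₁ hs
    exact Finset.card_pos.2 ⟨e, Finset.mem_filter.2 ⟨he, hd⟩⟩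

/-- The critical vertex of a triangle meeting `q` cannot be adjacent to both non-critical vertices
of a triangle disjoint from `q` that is seen by three edges of `M`. -/
lemma exists_not_adj_of_meeting (h : IsTopTiling H T M I) (hw : IsCriticalChoice H T M w)
    (hq : H.IsNClique 3 q) (hloc : IsLocated H T M w q) {s₀ s s₁ : Finset (Fin n)}
    (hs₀ : s₀ ∈ meeting T q) (hs : s ∈ T) (hsq : Disjoint q s) (hss₁ : s ≠ s₁)
    (hgood : ∀ s ∈ meeting T q, s ≠ s₀ → s ≠ s₁ → 3 ≤ (seers H M s).card)
    (hc : 3 ≤ (seers H M s).card) : ∃ y ∈ s.erase (w s), ¬ H.Adj y (w s₀) := by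
  by_contra! hadj
  have hsm : s ∉ meeting T q := fun hm => (Finset.mem_filter.1 hm).2 hsq
  have hs₀T := (Finset.mem_filter.1 hs₀).1
  obtain ⟨hc₀, hw₀⟩ := h.two_le_card_seers_of_mem_meeting hw hloc hs₀
  obtain ⟨hws₀, -⟩ := hw s₀ hs₀T hc₀
  obtain ⟨hws, hws', -⟩ := hw s hs (by omega)
  have hne : s ≠ s₀ := fun he => hsm (he ▸ hs₀)
  have hq'mem : ∀ y ∈ insert (w s₀) (s.erase (w s)), y = w s₀ ∨ y ∈ s := by
    intro y hy
    simp only [Finset.mem_insert, Finset.mem_erase] at hy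
    tauto
  have hq'T : ∀ y ∈ insert (w s₀) (s.erase (w s)), (∃ s ∈ T, y ∈ s) ∨ y ∈ I := by
    intro y hy
    rcases hq'mem y hy with rfl | hy
    · exact Or.inl ⟨s₀, hs₀T, hws₀⟩
    · exact Or.inl ⟨s, hs, hy⟩
  have hS : ∀ x ∈ insert s ((meeting T q).erase s₀), x = s ∨ x ∈ meeting T q ∧ x ≠ s₀ := by
    intro x hx
    simp only [Finset.mem_insert, Finset.mem_erase] at hx
    tauto
  have hfil : ∀ x, ((seers H M x).filter fun e =>
      Disjoint e q ∧ Disjoint e (insert (w s₀) (s.erase (w s))))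
      = (seers H M x).filter fun e => Disjoint e q := by
    intro x
    refine Finset.filter_congr fun e he => and_iff_left ?_
    exact h.disjoint_edge_of_forall_mem (mem_seers.1 he).1 hq'T
  have hcardS : (insert s ((meeting T q).erase s₀)).card = (meeting T q).card := by
    rw [Finset.card_insert_of_notMem (fun hm => hsm (Finset.mem_of_mem_erase hm)),
      Finset.card_erase_add_one hs₀]
  have hsum := h.card_meeting_add_le hq
  refine h.false_of_exchange_two (S := insert s ((meeting T q).erase s₀)) (r := s₀)
    (q' := insert (w s₀) (s.erase (w s))) w ?_ hs₀T ?_ ?_ hq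
    ((h.tri s hs).insert_erase_three hws hadj) ?_ ?_ ?_
    (card_le_card_biUnion_of_exceptional s₁ ?_ ?_)
  · intro x hx
    rcases hS x hx with rfl | ⟨hx, -⟩
    · exact hs
    · exact (Finset.mem_filter.1 hx).1
  · simp [hne.symm]
  · intro x hx
    rcases hS x hx with rfl | ⟨hx, -⟩
    · exact hws'
    · exact (hw x (Finset.mem_filter.1 hx).1
        (h.two_le_card_seers_of_mem_meeting hw hloc hx).1).2.1
  · rw [Finset.disjoint_right]
    intro y hy hyq
    rcases hq'mem y hy with rfl | hy
    · exact hw₀ hyq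
    · exact Finset.disjoint_left.1 hsq hyq hy
  · intro x hx hxS hxs₀
    have hxs : x ≠ s := fun he => hxS (he ▸ Finset.mem_insert_self _ _)
    have hxm : x ∉ meeting T q := fun hm =>
      hxS (Finset.mem_insert_of_mem (Finset.mem_erase.2 ⟨hxs₀, hm⟩))
    constructor
    · by_contra hd
      exact hxm (Finset.mem_filter.2 ⟨hx, hd⟩)
    · rw [Finset.disjoint_left]
      intro y hy
      rcases hq'mem y hy with rfl | hy
      · exact h.notMem_of_ne hs₀T hx hxs₀.symm hws₀
      · exact h.notMem_of_ne hs hx hxs.symm hy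
  · intro x hx
    rcases hS x hx with rfl | ⟨hx, hxs₀⟩
    · refine ⟨fun hm => Finset.disjoint_left.1 hsq hm hws, fun hm => ?_⟩
      simp only [Finset.mem_insert, Finset.mem_erase] at hm
      rcases hm with hm | hm
      · exact h.notMem_of_ne hs hs₀T hne hws (hm ▸ hws₀)
      · exact hm.1 rfl
    · obtain ⟨hxc, hxw⟩ := h.two_le_card_seers_of_mem_meeting hw hloc hx
      have hxT := (Finset.mem_filter.1 hx).1
      have hwx := (hw x hxT hxc).1
      refine ⟨hxw, fun hm => ?_⟩
      rcases hq'mem _ hm with hm | hm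
      · exact h.notMem_of_ne hxT hs₀T hxs₀ hwx (hm ▸ hws₀)
      · exact h.notMem_of_ne hxT hs (fun he => hsm (he ▸ hx)) hwx hm
  · intro x hx hxs₁
    rw [hcardS, hfil]
    have h3 := card_seers_le (H := H) (M := M) (q := q) x
    have : 3 ≤ (seers H M x).card := by
      rcases hS x hx with rfl | ⟨hx, hxs₀⟩
      · exact hc
      · exact hgood x hx hxs₀ hxs₁
    omega
  · intro hx
    rw [hfil]
    rcases hS _ hx with he | ⟨hx, hxs₀⟩
    · exact absurd he.symm hss₁
    · have h3 := card_seers_le (H := H) (M := M) (q := q) s₁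
      have h2 := (h.two_le_card_seers_of_mem_meeting hw hloc hx).1
      have : 1 < (meeting T q).card := Finset.one_lt_card.2 ⟨_, hx, _, hs₀, hxs₀⟩
      omega

lemma false_of_disjoint_triangles (h : IsTopTiling H T M I) {q : Finset (Fin n)} (hq : H.IsNClique 3 q)
    (hqX : ∀ s ∈ T, Disjoint q s) : False := by
  have hne : q.Nonempty := Finset.card_pos.1 (by rw [hq.card_eq]; omega)
  refine h.false_of_exchange_one (S := ∅) (fun _ => hne.choose) (by simp) (by simp) hq
    (fun s hs _ => hqX s hs) (by simp) ?_
  intro A hA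
  simp [Finset.subset_empty.1 hA]

lemma false_of_two_disjoint (h : IsTopTiling H T M I) {r q q' : Finset (Fin n)} (hr : r ∈ T)
    (hq : H.IsNClique 3 q) (hq' : H.IsNClique 3 q') (hqq : Disjoint q q')
    (hqT : ∀ s ∈ T, s ≠ r → Disjoint q s ∧ Disjoint q' s) : False := by
  have hne : q.Nonempty := Finset.card_pos.1 (by rw [hq.card_eq]; omega)
  refine h.false_of_exchange_two (S := ∅) (fun _ => hne.choose) (by simp) hr (by simp) (by simp)
    hq hq' hqq (fun s hs _ => hqT s hs) (by simp) ?_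
  intro A hA
  simp [Finset.subset_empty.1 hA]

end IsTopTiling

end Exchange

section Blocked

variable {n : ℕ} {H : SimpleGraph (Fin n)} {T M : Finset (Finset (Fin n))} {I : Finset (Fin n)}

lemma adjCount_le_three_of_no_disjoint_triangles {Y : Finset (Fin n)}
    (hY : ∀ q ⊆ Y, ∀ q' ⊆ Y, H.IsNClique 3 q → H.IsNClique 3 q' → ¬ Disjoint q q')
    {v : Fin 8 → Fin n} (hv : Function.Injective v) (hvY : ∀ i, v i ∈ Y)
    (h01 : H.Adj (v 0) (v 1)) (h02 : H.Adj (v 0) (v 2)) (h12 : H.Adj (v 1) (v 2))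
    (h03 : H.Adj (v 0) (v 3)) (h04 : H.Adj (v 0) (v 4)) (h34 : H.Adj (v 3) (v 4))
    (h05 : H.Adj (v 0) (v 5)) (h06 : H.Adj (v 0) (v 6)) (h56 : H.Adj (v 5) (v 6))
    (h13 : H.Adj (v 1) (v 3)) (h15 : H.Adj (v 1) (v 5)) (h35 : H.Adj (v 3) (v 5)) :
    adjCount H ((univ.erase 7).image v) {v 7} ≤ 3 := by
  classical
  set f : Fin 8 → ℕ := fun i => if H.Adj (v i) (v 7) then 1 else 0 with hf
  have no : ∀ i j k₁ k₂ k₃ : Fin 8, H.Adj (v i) (v j) → H.Adj (v k₁) (v k₂) →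
      H.Adj (v k₁) (v k₃) → H.Adj (v k₂) (v k₃) →
      Disjoint ({i, j, 7} : Finset (Fin 8)) {k₁, k₂, k₃} → f i + f j ≤ 1 := by
    intro i j k₁ k₂ k₃ hij h1 h2 h3 hd
    by_contra hc
    have hi : H.Adj (v i) (v 7) := by
      by_contra hi
      simp only [hf, hi] at hc
      split_ifs at hc <;> omega
    have hj : H.Adj (v j) (v 7) := by
      by_contra hj
      simp only [hf, hj] at hc
      split_ifs at hc <;> omega
    have himg : ∀ A : Finset (Fin 8), A.image v ⊆ Y := fun A =>
      Finset.image_subset_iff.2 fun i _ => hvY i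
    refine hY (Finset.image v {i, j, 7}) (himg _) (Finset.image v {k₁, k₂, k₃}) (himg _) ?_ ?_
      ((Finset.disjoint_image hv).2 hd)
    · simp only [Finset.image_insert, Finset.image_singleton]
      exact SimpleGraph.is3Clique_triple_iff.2 ⟨hij, hi, hj⟩
    · simp only [Finset.image_insert, Finset.image_singleton]
      exact SimpleGraph.is3Clique_triple_iff.2 ⟨h1, h2, h3⟩
  have n1 := no 1 2 0 3 4 h12 h03 h04 h34 (by decide)
  have n2 := no 3 4 0 1 2 h34 h01 h02 h12 (by decide)
  have n3 := no 5 6 0 1 2 h56 h01 h02 h12 (by decide)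
  have n4 := no 1 3 0 5 6 h13 h05 h06 h56 (by decide)
  have n5 := no 1 5 0 3 4 h15 h03 h04 h34 (by decide)
  have n6 := no 3 5 0 1 2 h35 h01 h02 h12 (by decide)
  have n7 := no 0 2 1 3 5 h02 h13 h15 h35 (by decide)
  have n8 := no 0 4 1 3 5 h04 h13 h15 h35 (by decide)
  have n9 := no 0 6 1 3 5 h06 h13 h15 h35 (by decide)
  have hsum : adjCount H ((univ.erase 7).image v) {v 7}
      = f 0 + f 1 + f 2 + f 3 + f 4 + f 5 + f 6 := by
    unfold adjCount
    rw [Finset.sum_image hv.injOn,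
      (by decide : (univ : Finset (Fin 8)).erase 7 = {0, 1, 2, 3, 4, 5, 6})]
    simp only [Finset.sum_singleton]
    rw [Finset.sum_insert (by decide), Finset.sum_insert (by decide),
      Finset.sum_insert (by decide), Finset.sum_insert (by decide),
      Finset.sum_insert (by decide), Finset.sum_insert (by decide), Finset.sum_singleton]
    simp only [hf, add_assoc]
  omega

lemma SimpleGraph.IsNClique.exists_eq_pair {e : Finset (Fin n)} (he : H.IsNClique 2 e) {b : Fin n}
    (hb : b ∈ e) : ∃ b', e = {b, b'} ∧ H.Adj b b' := by
  have h3 := he.card_eq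
  have h4 := Finset.card_erase_add_one hb
  obtain ⟨b', hb'⟩ := Finset.card_eq_one.1 (by omega : (e.erase b).card = 1)
  have hm : b' ∈ e.erase b := by simp [hb']
  refine ⟨b', by rw [← hb', Finset.insert_erase hb], ?_⟩
  exact he.1 hb (Finset.mem_of_mem_erase hm) (Finset.ne_of_mem_erase hm).symm

lemma SimpleGraph.IsNClique.exists_eq_triple {s : Finset (Fin n)} (hs : H.IsNClique 3 s) {x a : Fin n}
    (hx : x ∈ s) (ha : a ∈ s) (hax : a ≠ x) :
    ∃ a', s = {x, a, a'} ∧ H.Adj x a ∧ H.Adj x a' ∧ H.Adj a a' := by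
  have h3 := hs.card_eq
  have h4 := Finset.card_erase_add_one hx
  have ha2 : a ∈ s.erase x := Finset.mem_erase.2 ⟨hax, ha⟩
  have h5 := Finset.card_erase_add_one ha2
  obtain ⟨a', ha'⟩ := Finset.card_eq_one.1 (by omega : ((s.erase x).erase a).card = 1)
  have hsa : s = {x, a, a'} := by rw [← ha', Finset.insert_erase ha2, Finset.insert_erase hx]
  exact ⟨a', hsa, SimpleGraph.is3Clique_triple_iff.1 (hsa ▸ hs)⟩

namespace IsTopTiling

lemma disjoint_rest (h : IsTopTiling H T M I) {s : Finset (Fin n)} (hs : s ∈ T) :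
    Disjoint s (M.biUnion id ∪ I) := by
  rw [Finset.disjoint_right]
  intro v hv hvs
  simp only [Finset.mem_union, Finset.mem_biUnion, id] at hv
  rcases hv with ⟨e, he, hve⟩ | hv
  · exact Finset.disjoint_left.1 (h.triEdgeDisj s hs e he) hvs hve
  · exact (h.indepDisj v hv).1 s hs hvs

lemma two_mul_adjCount_rest_le (h : IsTopTiling H T M I) {R : Finset (Fin n)}
    (hR : R ⊆ M.biUnion id ∪ I) : 2 * adjCount H R R ≤ R.card ^ 2 := by
  refine two_mul_adjCount_self_le H fun a ha b hb c hc hab hbc hac => ?_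
  refine h.false_of_disjoint_triangles (q := {a, b, c})
    (SimpleGraph.is3Clique_triple_iff.2 ⟨hab, hac, hbc⟩) fun s hs => ?_
  refine (h.disjoint_rest hs).symm.mono_left (subset_trans ?_ hR)
  intro y
  simp only [Finset.mem_insert, Finset.mem_singleton]
  rintro (rfl | rfl | rfl) <;> assumption

lemma card_rest (h : IsTopTiling H T M I) :
    (M.biUnion id ∪ I).card = 2 * M.card + I.card := by
  rw [Finset.card_union_of_disjoint, Finset.card_biUnion]
  · rw [Finset.sum_congr rfl fun e (he : e ∈ M) => show (id e).card = 2 from (h.edge e he).card_eq]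
    simp [mul_comm]
  · exact fun e he e' he' hne => h.edgeDisj e he e' he' hne
  · rw [Finset.disjoint_right]
    intro v hv hve
    obtain ⟨e, he, hve⟩ := Finset.mem_biUnion.1 hve
    exact (h.indepDisj v hv).2 e he hve

lemma univ_eq (h : IsTopTiling H T M I) : univ = T.biUnion id ∪ (M.biUnion id ∪ I) := by
  symm
  rw [Finset.eq_univ_iff_forall]
  intro v
  simpa using h.cover v

lemma disjoint_biUnion_rest (h : IsTopTiling H T M I) :
    Disjoint (T.biUnion id) (M.biUnion id ∪ I) := by
  rw [Finset.disjoint_biUnion_left]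
  exact fun s hs => h.disjoint_rest hs

lemma card_eq (h : IsTopTiling H T M I) : n = 3 * T.card + (2 * M.card + I.card) := by
  have h1 : (univ : Finset (Fin n)).card = n := by simp
  rw [h.univ_eq, Finset.card_union_of_disjoint h.disjoint_biUnion_rest, h.card_rest,
    Finset.card_biUnion, Finset.sum_congr rfl
      fun s (hs : s ∈ T) => show (id s).card = 3 from (h.tri s hs).card_eq] at h1
  · simp at h1
    omega
  · exact fun e he e' he' hne => h.triDisj e he e' he' hne

lemma two_mul_ncard_edgeSet (h : IsTopTiling H T M I) :
    2 * H.edgeSet.ncard = ∑ s ∈ T, ∑ s' ∈ T, adjCount H s s'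
      + 2 * ∑ s ∈ T, adjCount H s (M.biUnion id ∪ I)
      + adjCount H (M.biUnion id ∪ I) (M.biUnion id ∪ I) := by
  have hT : (T : Set (Finset (Fin n))).Pairwise fun s₁ s₂ => Disjoint s₁ s₂ :=
    fun e he e' he' hne => h.triDisj e he e' he' hne
  rw [← adjCount_univ, h.univ_eq, adjCount_union_self H h.disjoint_biUnion_rest,
    adjCount_biUnion_left H hT, adjCount_biUnion_left H hT]
  simp only [adjCount_biUnion_right H hT]

/-- If two edges of `M` seeing a triangle of `T` span, with a non-critical vertex of it, a further
triangle, then the triangle and the vertices outside of `T` span few edges. -/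
lemma two_mul_adjCount_le_of_blocked (h : IsTopTiling H T M I) {s e₁ e₂ : Finset (Fin n)}
    (hs : s ∈ T) (he₁ : e₁ ∈ M) (he₂ : e₂ ∈ M) (hne : e₁ ≠ e₂) {x a b c : Fin n}
    (h₁ : seesAt H e₁ s x) (h₂ : seesAt H e₂ s x) (ha : a ∈ s) (hax : a ≠ x)
    (hb : b ∈ e₁) (hc : c ∈ e₂) (hab : H.Adj a b) (hac : H.Adj a c) (hbc : H.Adj b c)
    {r : ℕ} (hr : (M.biUnion id ∪ I).card = r + 4) :
    2 * (adjCount H s s + 2 * adjCount H s (M.biUnion id ∪ I)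
      + adjCount H (M.biUnion id ∪ I) (M.biUnion id ∪ I)) ≤ 98 + 12 * r + r ^ 2 := by
  obtain ⟨a', hsa, i1, i2, i3⟩ := (h.tri s hs).exists_eq_triple h₁.1 ha hax
  obtain ⟨b', hb', hbb⟩ := (h.edge e₁ he₁).exists_eq_pair hb
  obtain ⟨c', hc', hcc⟩ := (h.edge e₂ he₂).exists_eq_pair hc
  set X := M.biUnion id ∪ I with hX
  have hsX := h.disjoint_rest hs
  have hde := h.edgeDisj e₁ he₁ e₂ he₂ hne
  have heX : e₁ ∪ e₂ ⊆ X := by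
    intro v hv
    rcases Finset.mem_union.1 hv with hv | hv
    · exact Finset.mem_union_left _ (Finset.mem_biUnion.2 ⟨_, he₁, hv⟩)
    · exact Finset.mem_union_left _ (Finset.mem_biUnion.2 ⟨_, he₂, hv⟩)
  have hno : ∀ q ⊆ s ∪ X, ∀ q' ⊆ s ∪ X, H.IsNClique 3 q → H.IsNClique 3 q' →
      ¬ Disjoint q q' := by
    intro q hq q' hq' hcq hcq' hd
    refine h.false_of_two_disjoint hs hcq hcq' hd fun u hu hus => ?_
    have : Disjoint (s ∪ X) u := by
      rw [Finset.disjoint_union_left]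
      exact ⟨h.triDisj s hs u hu hus.symm, (h.disjoint_rest hu).symm⟩
    exact ⟨this.mono_left hq, this.mono_left hq'⟩
  have hWR : Disjoint (s ∪ (e₁ ∪ e₂)) (X \ (e₁ ∪ e₂)) := by
    rw [Finset.disjoint_union_left]
    exact ⟨hsX.mono_right Finset.sdiff_subset, Finset.disjoint_sdiff⟩
  have hsplit : s ∪ X = (s ∪ (e₁ ∪ e₂)) ∪ (X \ (e₁ ∪ e₂)) := by
    rw [Finset.union_assoc, Finset.union_sdiff_of_subset heX]
  have hcard4 : (e₁ ∪ e₂).card = 4 := by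
    rw [Finset.card_union_of_disjoint hde, (h.edge e₁ he₁).card_eq, (h.edge e₂ he₂).card_eq]
  have hcardR : (X \ (e₁ ∪ e₂)).card = r := by
    rw [Finset.card_sdiff_of_subset heX, hcard4, hr]
    omega
  have hcardW : (s ∪ (e₁ ∪ e₂)).card = 7 := by
    rw [Finset.card_union_of_disjoint (hsX.mono_right heX), hcard4, (h.tri s hs).card_eq]
  have hW : s ∪ (e₁ ∪ e₂) = {x, a, a', b, b', c, c'} := by
    rw [hsa, hb', hc']
    ext y
    simp only [Finset.mem_union, Finset.mem_insert, Finset.mem_singleton]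
    tauto
  have hWR3 : adjCount H (s ∪ (e₁ ∪ e₂)) (X \ (e₁ ∪ e₂)) ≤ 3 * r := by
    rw [adjCount_eq_sum_right, ← hcardR, mul_comm, ← smul_eq_mul]
    refine Finset.sum_le_card_nsmul _ _ _ fun p hp => ?_
    have hp7 : p ∉ s ∪ (e₁ ∪ e₂) := Finset.disjoint_right.1 hWR hp
    have hi : univ.image ![x, a, a', b, b', c, c', p] = insert p (s ∪ (e₁ ∪ e₂)) := by
      rw [hW]
      ext y
      simp only [Finset.mem_image, Finset.mem_univ, true_and, Fin.exists_fin_succ,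
        Finset.mem_insert, Finset.mem_singleton]
      simp [eq_comm]
      tauto
    have hinj : Function.Injective ![x, a, a', b, b', c, c', p] := by
      rw [← Set.injOn_univ, ← Finset.coe_univ, ← Finset.card_image_iff, hi, Finset.card_insert_of_notMem hp7,
        hcardW]
      simp
    have := adjCount_le_three_of_no_disjoint_triangles hno hinj ?_ i1 i2 i3
      (h₁.2 b hb).symm (h₁.2 b' (by simp [hb'])).symm hbb
      (h₂.2 c hc).symm (h₂.2 c' (by simp [hc'])).symm hcc hab hac hbc
    · rw [Finset.image_erase hinj, hi] at this
      simpa [Finset.erase_insert hp7] using this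
    · intro i
      have : ![x, a, a', b, b', c, c', p] i ∈ univ.image ![x, a, a', b, b', c, c', p] :=
        Finset.mem_image_of_mem _ (Finset.mem_univ _)
      rw [hi] at this
      rw [hsplit]
      refine Finset.insert_subset (Finset.mem_union_right _ hp) Finset.subset_union_left this
  have hRR := h.two_mul_adjCount_rest_le (R := X \ (e₁ ∪ e₂)) Finset.sdiff_subset
  have hWW := adjCount_le_mul H (s ∪ (e₁ ∪ e₂)) (s ∪ (e₁ ∪ e₂))
  rw [hcardW] at hWW
  rw [hcardR] at hRR
  rw [← adjCount_union_self H hsX, hsplit, adjCount_union_self H hWR]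
  omega

end IsTopTiling

end Blocked

section Triangle

variable {n : ℕ} {H : SimpleGraph (Fin n)} {T M : Finset (Finset (Fin n))} {I : Finset (Fin n)}

namespace IsTopTiling

variable {w : Finset (Fin n) → Fin n} {q : Finset (Fin n)}

lemma sum_adjCount_rest_le (h : IsTopTiling H T M I) (hw : IsCriticalChoice H T M w)
    {T' B : Finset (Finset (Fin n))} (hT' : T' ⊆ T) (hB : B ⊆ T')
    (hc : ∀ s ∈ B, (seers H M s).card ≤ 2) (hI : 3 + I.card ≤ M.card) :
    ∑ s ∈ T', adjCount H s (M.biUnion id ∪ I) + B.card * M.card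
      ≤ T'.card * (4 * M.card + 2 * I.card) + B.card * (3 + I.card) := by
  classical
  have h1 : ∑ s ∈ T' \ B, adjCount H s (M.biUnion id ∪ I)
      ≤ (T' \ B).card * (4 * M.card + 2 * I.card) := by
    rw [← smul_eq_mul]
    refine Finset.sum_le_card_nsmul _ _ _ fun s hs => ?_
    have hs := hT' (Finset.mem_sdiff.1 hs).1
    have hM : (seers H M s).card ≤ M.card :=
      Finset.card_le_card fun e he => (mem_seers.1 he).1
    rcases Nat.lt_or_ge 2 (seers H M s).card with h2 | h2
    · have := h.adjCount_rest_le hw hs h2.le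
      omega
    · have := h.adjCount_rest_le_of_card_seers_le_two hw hs h2
      omega
  have h2 : ∑ s ∈ B, adjCount H s (M.biUnion id ∪ I)
      ≤ B.card * (3 * M.card + 3 + 3 * I.card) := by
    rw [← smul_eq_mul]
    exact Finset.sum_le_card_nsmul _ _ _ fun s hs =>
      h.adjCount_rest_le_of_card_seers_le_two hw (hT' (hB hs)) (hc s hs)
  have h3 := Finset.sum_sdiff (f := fun s => adjCount H s (M.biUnion id ∪ I)) hB
  have h4 := Finset.card_sdiff_add_card_eq_card hB
  rw [← h3, ← h4]
  nlinarith

/-- A top tiling with the extremal number of edges and almost all triangles seen by two edges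
of `M` has no triangle all of whose vertices are located. -/
lemma false_of_isLocated (h : IsTopTiling H T M I) (hw : IsCriticalChoice H T M w) {t : ℕ}
    (hT : T.card = t + 1) (hL : t + 1 ≤ (T.filter fun s => 2 ≤ (seers H M s).card).card + 2)
    (hn : 20000 ≤ n) (ht : 9 * t ≤ 2 * n + 3) (hI : 100 * I.card ≤ n)
    (hE : 2 * (n : ℤ) ^ 2 + 8 ≤ 4 * H.edgeSet.ncard + 1 + 2 * t + (n - t) ^ 2)
    (hq : H.IsNClique 3 q) (hloc : IsLocated H T M w q) : False := by
  classical
  set X := M.biUnion id ∪ I with hX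
  have hnX := h.card_eq
  rw [hT] at hnX
  have hXX := h.two_mul_adjCount_rest_le (Finset.Subset.refl X)
  rw [h.card_rest] at hXX
  have hedges := h.two_mul_ncard_edgeSet
  have hI3 : 3 + I.card ≤ M.card := by omega
  set L := T.filter fun s => 2 ≤ (seers H M s).card with hLdef
  set U := T.filter fun s => ¬ 2 ≤ (seers H M s).card with hUdef
  set B := T.filter fun s => (seers H M s).card ≤ 2 with hBdef
  have hLU : Disjoint L U := Finset.disjoint_filter_filter_not _ _ _
  have hLUT : L ∪ U = T := Finset.filter_union_filter_not_eq _ _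
  have hU : U.card ≤ 2 := by
    have := Finset.card_union_of_disjoint hLU
    rw [hLUT] at this
    omega
  have hL2 : ∀ s ∈ L, 2 ≤ (seers H M s).card := fun s hs => (Finset.mem_filter.1 hs).2
  have hB2 : ∀ s ∈ B, (seers H M s).card ≤ 2 := fun s hs => (Finset.mem_filter.1 hs).2
  have hBT : B ⊆ T := Finset.filter_subset _ _
  rcases Nat.lt_or_ge 2 B.card with hB3 | hB3
  · obtain ⟨B', hB', hB'3⟩ := Finset.exists_subset_card_eq hB3
    have h1 := h.sum_sum_adjCount_le hw hLU hLUT hL2 hU (s₀ := ∅) (G := ∅) (by simp) (by simp)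
      (by simp)
    have h2 := h.sum_adjCount_rest_le hw (Finset.Subset.refl T) (hB'.trans hBT)
      (fun s hs => hB2 s (hB' hs)) hI3
    rw [hB'3] at h2
    rw [hT] at h1 h2
    simp only [Finset.card_empty] at h1
    zify at *
    rw [hnX] at hE
    nlinarith
  by_cases hex : ∃ s₀ ∈ meeting T q, s₀ ∈ B
  swap
  · push Not at hex
    refine h.false_of_three_le_card_seers hw hq hloc ∅ (fun s hs _ => ?_) ?_
    · by_contra! hc
      exact hex s hs (Finset.mem_filter.2 ⟨(Finset.mem_filter.1 hs).1, by omega⟩)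
    · intro hm
      exact absurd (Finset.disjoint_empty_right _) (Finset.mem_filter.1 hm).2
  obtain ⟨s₀, hs₀, hs₀B⟩ := hex
  have hs₀T := hBT hs₀B
  obtain ⟨hs₀2, hws₀⟩ := h.two_le_card_seers_of_mem_meeting hw hloc hs₀
  have hs₀L : s₀ ∈ L := Finset.mem_filter.2 ⟨hs₀T, hs₀2⟩
  have hmeet := h.card_meeting_add_le hq
  set G := T.filter fun s => Disjoint q s ∧ 3 ≤ (seers H M s).card with hGdef
  have hGL : G ⊆ L.erase s₀ := by
    intro s hs
    obtain ⟨hs, hd, hc⟩ := Finset.mem_filter.1 hs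
    refine Finset.mem_erase.2 ⟨?_, Finset.mem_filter.2 ⟨hs, by omega⟩⟩
    rintro rfl
    exact (Finset.mem_filter.1 hs₀).2 hd
  have hGcard : t + 1 ≤ G.card + 5 := by
    have hsub : T ⊆ G ∪ (meeting T q ∪ B) := by
      intro s hs
      simp only [hGdef, hBdef, meeting, Finset.mem_union, Finset.mem_filter]
      have : (seers H M s).card ≤ 2 ∨ 3 ≤ (seers H M s).card := by omega
      tauto
    have h1 := Finset.card_le_card hsub
    have h2 := Finset.card_union_le G (meeting T q ∪ B)
    have h3 := Finset.card_union_le (meeting T q) B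
    omega
  have hsix : ∀ s₁ : Finset (Fin n), (∀ s ∈ B, s = s₀ ∨ s = s₁) → s₁ ∈ B →
      ∀ s ∈ G, adjCount H s s₀ ≤ 6 := by
    intro s₁ hBs hs₁ s hs
    have hss₀ := Finset.ne_of_mem_erase (hGL hs)
    obtain ⟨hs, hd, hc⟩ := Finset.mem_filter.1 hs
    refine h.adjCount_le_six hw hs hs₀T hss₀ (by omega) hs₀2
      (h.exists_not_adj_of_meeting hw hq hloc hs₀ hs hd (s₁ := s₁) ?_ ?_ hc)
    · rintro rfl
      have := hB2 _ hs₁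
      omega
    · intro s' hs' h0 h1
      by_contra! hc'
      rcases hBs s' (Finset.mem_filter.2 ⟨(Finset.mem_filter.1 hs').1, by omega⟩) with he | he
      · exact h0 he
      · exact h1 he
  by_cases hs₁ : ∃ s₁ ∈ B, s₁ ≠ s₀
  · obtain ⟨s₁, hs₁, hne⟩ := hs₁
    have hsub : ({s₀, s₁} : Finset (Finset (Fin n))) ⊆ B := by
      simp [Finset.insert_subset_iff, hs₀B, hs₁]
    have hcard2 : ({s₀, s₁} : Finset (Finset (Fin n))).card = 2 := Finset.card_pair hne.symm
    have hBeq := Finset.eq_of_subset_of_card_le hsub (by omega)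
    have h1 := h.sum_sum_adjCount_le hw hLU hLUT hL2 hU hGL (fun _ => hs₀L)
      (hsix s₁ (fun s hs => by rw [← hBeq] at hs; simpa using hs) hs₁)
    have h2 := h.sum_adjCount_rest_le hw (Finset.Subset.refl T) hBT hB2 hI3
    rw [← hBeq, hcard2] at h2
    rw [hT] at h1 h2
    clear_value G
    zify at *
    rw [hnX] at hE
    nlinarith
  · push Not at hs₁
    by_cases hfree : ∃ e ∈ seers H M s₀, Disjoint e q
    · refine h.false_of_three_le_card_seers hw hq hloc s₀ (fun s hs hne => ?_) fun _ => hfree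
      by_contra! hc
      exact hne (hs₁ s (Finset.mem_filter.2 ⟨(Finset.mem_filter.1 hs).1, by omega⟩))
    push Not at hfree
    obtain ⟨e₁, he₁, e₂, he₂, hne⟩ := Finset.one_lt_card.1 hs₀2
    obtain ⟨-, hcrit, -⟩ := hw s₀ hs₀T hs₀2
    obtain ⟨a, haq, ha⟩ := Finset.not_disjoint_iff.1 (Finset.mem_filter.1 hs₀).2
    obtain ⟨b, hb, hbq⟩ := Finset.not_disjoint_iff.1 (hfree e₁ he₁)
    obtain ⟨c, hc, hcq⟩ := Finset.not_disjoint_iff.1 (hfree e₂ he₂)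
    have he₁M := (mem_seers.1 he₁).1
    have he₂M := (mem_seers.1 he₂).1
    obtain ⟨r, hr⟩ : ∃ r, X.card = r + 4 := by
      have hXc : X.card = 2 * M.card + I.card := h.card_rest
      exact ⟨X.card - 4, by omega⟩
    have hblk := h.two_mul_adjCount_le_of_blocked hs₀T he₁M he₂M hne (hcrit e₁ he₁)
      (hcrit e₂ he₂) ha (fun he => hws₀ (he ▸ haq)) hb hc
      (hq.1 haq hbq fun he =>
        Finset.disjoint_left.1 (h.triEdgeDisj s₀ hs₀T e₁ he₁M) ha (he ▸ hb))
      (hq.1 haq hcq fun he =>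
        Finset.disjoint_left.1 (h.triEdgeDisj s₀ hs₀T e₂ he₂M) ha (he ▸ hc))
      (hq.1 hbq hcq fun he =>
        Finset.disjoint_left.1 (h.edgeDisj e₁ he₁M e₂ he₂M hne) hb (he ▸ hc)) hr
    have h1 := h.sum_sum_adjCount_le hw hLU hLUT hL2 hU hGL (fun _ => hs₀L)
      (hsix s₀ (fun s hs => Or.inl (hs₁ s hs)) hs₀B)
    have h2 := h.sum_adjCount_rest_le hw (Finset.erase_subset s₀ T) (Finset.empty_subset _)
      (by simp) hI3
    have h3 := Finset.add_sum_erase T (fun s => adjCount H s X) hs₀T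
    have h4 : (T.erase s₀).card = t := by
      rw [Finset.card_erase_of_mem hs₀T]
      omega
    have hr' : r + 4 = 2 * M.card + I.card := hr.symm.trans h.card_rest
    rw [h4] at h2
    rw [← h3] at hedges
    rw [hT] at h1
    simp only [Finset.card_empty, zero_mul, add_zero] at h2
    clear_value G
    clear hXX hr h3 h4 hmeet hL hs₀2 hU hB3
    zify at *
    have hr4 : (r : ℤ) = 2 * M.card + I.card - 4 := by linarith
    rw [hr4] at hblk
    rw [hnX] at hE
    linarith

end IsTopTiling

end Triangle

/-- Claim 4.9. Under the stability conclusions, letting `V'` be the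
set of non-critical vertices of the triangles of `T₁`, the subgraph of `H` induced by
`V(M) ∪ V'` is triangle-free. -/
theorem statement17 (δ : ℝ) (hδ : 0 < δ) :
    ∃ N₀ : ℕ, ∀ n : ℕ, N₀ ≤ n → ∀ t : ℕ,
      δ * n ≤ t → (t : ℝ) ≤ (2 * n - 6) / 9 + 1 →
      ∀ χ : Sym2 (Fin n) → ℕ,
        IsSurjColoring n (exTriangles n (t + 1) + 2) χ →
        ¬ HasRainbowKTriangles (⊤ : SimpleGraph (Fin n)) χ (t + 2) →
        ∀ H : SimpleGraph (Fin n), IsRepGraph χ (exTriangles n (t + 1) + 2) H →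
        ∀ (T M : Finset (Finset (Fin n))) (I : Finset (Fin n)),
          IsMaxTilingTriple H T M I →
          ∀ T₁ T₂ T₃ T₄ : Finset (Finset (Fin n)),
            IsIdealPartition H T M I T₁ T₂ T₃ T₄ →
            (t - 1 ≤ T₁.card ∧ T₁.card ≤ t + 1) →
            (((n : ℝ) - 3 * (t + 1)) / 2 - Real.sqrt (2 * n) / 2 < M.card ∧
              (M.card : ℝ) ≤ ((n : ℝ) - 3 * (t + 1)) / 2) →
            (I.card : ℝ) < Real.sqrt (2 * n) →
            (H.induce ((↑(M.biUnion id) : Set (Fin n)) ∪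
              nonCriticalVerts H M T₁)).CliqueFree 3 := by
  refine ⟨20000, ?_⟩
  intro n hn t _ ht χ _ hrb H hH T M I hmax T₁ T₂ T₃ T₄ hideal hT₁ _ hI
  classical
  have h := hmax.isTopTiling
  have hpw : (T : Set (Finset (Fin n))).Pairwise fun s₁ s₂ => Disjoint s₁ s₂ :=
    fun s hs s' hs' hne => h.triDisj s hs s' hs' hne
  have ht9 : 9 * t ≤ 2 * n + 3 := by
    have : (9 * t : ℝ) ≤ 2 * n + 3 := by linarith
    exact_mod_cast this
  have hI100 : 100 * I.card ≤ n := by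
    have h1 : (I.card : ℝ) ^ 2 < 2 * n := (Real.lt_sqrt (by positivity)).1 hI
    have h2 : I.card ^ 2 < 2 * n := by exact_mod_cast h1
    nlinarith
  have hT : T.card = t + 1 := by
    refine le_antisymm (card_le_of_not_hasRainbow hrb hH.2 h.tri hpw) ?_
    obtain ⟨Q, hQ, hc, hd⟩ := hasKDisjointTriangles_of_lt (H := H) (k := t + 1)
      (by rw [hH.1]; omega)
    exact hQ ▸ h.max Q hc hd
  have hL : t + 1 ≤ (T.filter fun s => 2 ≤ (seers H M s).card).card + 2 := by
    have : T₁ ⊆ T.filter fun s => 2 ≤ (seers H M s).card := by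
      intro s hs
      obtain ⟨hsT, e₁, he₁, e₂, he₂, hne, h1, h2⟩ := (hideal.2.2.2.2.2.2.2.1 s).1 hs
      exact Finset.mem_filter.2 ⟨hsT, Finset.one_lt_card.2
        ⟨e₁, mem_seers.2 ⟨he₁, h1⟩, e₂, mem_seers.2 ⟨he₂, h2⟩, hne⟩⟩
    have := Finset.card_le_card this
    omega
  have hE : 2 * (n : ℤ) ^ 2 + 8 ≤ 4 * H.edgeSet.ncard + 1 + 2 * t + (n - t) ^ 2 := by
    have := exTriangles_lower_bound (n := n) (t := t) (by omega)
    rw [hH.1]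
    push_cast
    linarith
  obtain ⟨w, hw⟩ := h.exists_critical (Finset.card_pos.1 (by omega))
  rw [SimpleGraph.cliqueFree_iff]
  refine ⟨fun f => ?_⟩
  have hq : H.IsNClique 3 {(f 0).1, (f 1).1, (f 2).1} :=
    SimpleGraph.is3Clique_triple_iff.2 ⟨f.toHom.map_adj (by simp), f.toHom.map_adj (by simp),
      f.toHom.map_adj (by simp)⟩
  refine h.false_of_isLocated hw hT hL hn ht9 hI100 hE hq fun v hv => ?_
  obtain ⟨i, rfl⟩ : ∃ i, v = (f i).1 := by
    simp only [Finset.mem_insert, Finset.mem_singleton] at hv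
    rcases hv with rfl | rfl | rfl
    exacts [⟨_, rfl⟩, ⟨_, rfl⟩, ⟨_, rfl⟩]
  rcases (f i).2 with hM | ⟨s, hs, x, ⟨-, ⟨e, he, hex⟩, -⟩, hvs, hvx⟩
  · left
    simpa using hM
  · right
    obtain ⟨hsT, e₁, he₁, e₂, he₂, hne, h1, h2⟩ := (hideal.2.2.2.2.2.2.2.1 s).1 hs
    have hc : 2 ≤ (seers H M s).card := Finset.one_lt_card.2
      ⟨e₁, mem_seers.2 ⟨he₁, h1⟩, e₂, mem_seers.2 ⟨he₂, h2⟩, hne⟩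
    exact ⟨s, hsT, hc, hvs, fun heq => hvx (heq.trans ((hw s hsT hc).2.2 e he x hex).symm)⟩
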